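/- Let K ⊆ ℝ² be a triangulated 2-disk transverse to the verticals, and let v : ∂K → ℝ² be a vertical simplexwise-linear embedding such that v(∂K) is convex and K has no v-obstructive spanning edge. Then v extends to a vertical simplexwise-linear embedding of K into ℝ². -/

import Mathlib

/-! Basic notions for triangulated 2-disks with straight simplices in the plane. -/

/-- Vertex set of an ordered triangle. -/
def vset {ι : Type} [DecidableEq ι] (t : ι × ι × ι) : Finset ι := {t.1, t.2.1, t.2.2}

/-- The geometric (closed, filled) triangle spanned by an ordered triple of vertices. -/
def triSet {ι : Type} (pos : ι → ℝ × ℝ) (t : ι × ι × ι) : Set (ℝ × ℝ) :=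
  convexHull ℝ {pos t.1, pos t.2.1, pos t.2.2}

/-- A triangulated 2-disk with straight (affine) simplices in the plane: finitely many
nondegenerate affine triangles, any two of which intersect exactly in the convex hull of
their common vertices, whose union is homeomorphic to the closed 2-disk. -/
structure TriDisk (ι : Type) [Fintype ι] [DecidableEq ι] where
  pos : ι → ℝ × ℝ
  inj : Function.Injective pos
  tris : Finset (ι × ι × ι)
  nonempty : tris.Nonempty
  indep : ∀ t ∈ tris, AffineIndependent ℝ ![pos t.1, pos t.2.1, pos t.2.2]
  glue : ∀ s ∈ tris, ∀ t ∈ tris,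
    triSet pos s ∩ triSet pos t = convexHull ℝ (pos '' ((vset s ∩ vset t : Finset ι) : Set ι))
  disk : Nonempty ((⋃ t ∈ tris, triSet pos t) ≃ₜ
      (Metric.closedBall (0 : EuclideanSpace ℝ (Fin 2)) 1))

namespace TriDisk

variable {ι : Type} [Fintype ι] [DecidableEq ι]

/-- The underlying space of the triangulated disk. -/
def space (D : TriDisk ι) : Set (ℝ × ℝ) := ⋃ t ∈ D.tris, triSet D.pos t

/-- `a b` span an edge (1-simplex) of the triangulation. -/
def IsEdge (D : TriDisk ι) (a b : ι) : Prop :=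
  a ≠ b ∧ ∃ t ∈ D.tris, a ∈ vset t ∧ b ∈ vset t

/-- A spanning edge: both endpoints on the boundary circle, open edge in the interior. -/
def IsSpanningEdge (D : TriDisk ι) (a b : ι) : Prop :=
  D.IsEdge a b ∧ D.pos a ∈ frontier D.space ∧ D.pos b ∈ frontier D.space ∧
    openSegment ℝ (D.pos a) (D.pos b) ⊆ interior D.space

/-- `K` is simple if it has no spanning edge. -/
def Simple (D : TriDisk ι) : Prop := ∀ a b : ι, ¬ D.IsSpanningEdge a b

/-- Transverse to the verticals: every intersection with a vertical line is connected. -/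
def TrV (D : TriDisk ι) : Prop :=
  ∀ c : ℝ, IsPreconnected (D.space ∩ {p : ℝ × ℝ | p.1 = c})

/-- A boundary edge of the triangulation. -/
def IsBoundaryEdge (D : TriDisk ι) (a b : ι) : Prop :=
  D.IsEdge a b ∧ segment ℝ (D.pos a) (D.pos b) ⊆ frontier D.space

/-- A roof edge: a boundary edge no ascending vertical ray from which meets the interior. -/
def IsRoofEdge (D : TriDisk ι) (a b : ι) : Prop :=
  D.IsBoundaryEdge a b ∧
    ∀ p ∈ segment ℝ (D.pos a) (D.pos b), ∀ s : ℝ, 0 ≤ s →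
      (p.1, p.2 + s) ∉ interior D.space

/-- The roof of a TrV disk, as a subset of the boundary. -/
def roof (D : TriDisk ι) : Set (ℝ × ℝ) :=
  ⋃ (a : ι) (b : ι) (_ : D.IsRoofEdge a b), segment ℝ (D.pos a) (D.pos b)

/-- `F` is simplexwise linear on the boundary of `D`. -/
def SLOnBoundary (D : TriDisk ι) (F : ℝ × ℝ → ℝ × ℝ) : Prop :=
  ∀ a b : ι, D.IsBoundaryEdge a b →
    ∃ g : (ℝ × ℝ) →ᵃ[ℝ] (ℝ × ℝ), Set.EqOn F g (segment ℝ (D.pos a) (D.pos b))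

/-- `F` is simplexwise linear on the whole disk `D`. -/
def SLOn (D : TriDisk ι) (F : ℝ × ℝ → ℝ × ℝ) : Prop :=
  ∀ t ∈ D.tris, ∃ g : (ℝ × ℝ) →ᵃ[ℝ] (ℝ × ℝ), Set.EqOn F g (triSet D.pos t)

/-- `F` is vertical on `S`: it preserves first coordinates there. -/
def VerticalOn (F : ℝ × ℝ → ℝ × ℝ) (S : Set (ℝ × ℝ)) : Prop :=
  ∀ p ∈ S, (F p).1 = p.1

/-- The image of the boundary under `F` is a convex polygon, i.e. it is the boundary
of a compact convex set with nonempty interior. -/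
def ConvexImage (D : TriDisk ι) (F : ℝ × ℝ → ℝ × ℝ) : Prop :=
  ∃ C : Set (ℝ × ℝ), Convex ℝ C ∧ IsCompact C ∧ (interior C).Nonempty ∧
    F '' frontier D.space = frontier C

/-- A spanning edge `{a,b}` is `F`-obstructive: `F` maps (the closure of) one of the two
arcs of the boundary circle determined by its endpoints into a straight line. -/
def Obstructive (D : TriDisk ι) (F : ℝ × ℝ → ℝ × ℝ) (a b : ι) : Prop :=
  D.IsSpanningEdge a b ∧ ∃ x ∈ frontier D.space \ {D.pos a, D.pos b},
    Collinear ℝ (F '' closure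
      (connectedComponentIn (frontier D.space \ {D.pos a, D.pos b}) x))

end TriDisk

namespace TriDisk

set_option linter.unusedSectionVars false

variable {ι : Type} [Fintype ι] [DecidableEq ι]

lemma aff_sum (f : (ℝ × ℝ) →ᵃ[ℝ] ℝ) (w : ι → ℝ) (q : ι → ℝ × ℝ) (hw : ∑ i, w i = 1) :
    f (∑ i, w i • q i) = ∑ i, w i * f (q i) := by
  have h : ∀ p, f p = f.linear p + f 0 := fun p => by
    have := congrFun (AffineMap.decomp f) p
    simpa using this
  rw [h, map_sum]
  simp_rw [h (q _), mul_add, Finset.sum_add_distrib, ← Finset.sum_mul, hw, map_smul, smul_eq_mul,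
    one_mul]

lemma exists_bc (D : TriDisk ι) (t : ι × ι × ι) (ht : t ∈ D.tris) :
    ∃ f : ι → ((ℝ × ℝ) →ᵃ[ℝ] ℝ),
      (∀ i, i ∉ vset t → f i = 0) ∧
      (∀ p, ∑ i, f i p = 1) ∧
      (∀ p, ∑ i, f i p • D.pos i = p) ∧
      (∀ p, p ∈ triSet D.pos t ↔ ∀ i, 0 ≤ f i p) ∧
      (∀ i, ∀ j ∈ vset t, f i (D.pos j) = if i = j then 1 else 0) := by
  have hi := D.indep t ht
  have htop : affineSpan ℝ (Set.range ![D.pos t.1, D.pos t.2.1, D.pos t.2.2]) = ⊤ := by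
    rw [hi.affineSpan_eq_top_iff_card_eq_finrank_add_one]
    simp
  let b : AffineBasis (Fin 3) ℝ (ℝ × ℝ) := ⟨_, hi, htop⟩
  have hb0 : b 0 = D.pos t.1 := rfl
  have hb1 : b 1 = D.pos t.2.1 := rfl
  have hb2 : b 2 = D.pos t.2.2 := rfl
  obtain ⟨i0, i1, i2⟩ := t
  simp only at hb0 hb1 hb2
  have h01 : i0 ≠ i1 := fun h => by
    have := b.ind.injective.ne (show (0 : Fin 3) ≠ 1 by decide)
    exact this (by change b 0 = b 1; rw [hb0, hb1, h])
  have h02 : i0 ≠ i2 := fun h => by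
    have := b.ind.injective.ne (show (0 : Fin 3) ≠ 2 by decide)
    exact this (by change b 0 = b 2; rw [hb0, hb2, h])
  have h12 : i1 ≠ i2 := fun h => by
    have := b.ind.injective.ne (show (1 : Fin 3) ≠ 2 by decide)
    exact this (by change b 1 = b 2; rw [hb1, hb2, h])
  let f : ι → ((ℝ × ℝ) →ᵃ[ℝ] ℝ) := fun i =>
    if i = i0 then b.coord 0 else if i = i1 then b.coord 1 else if i = i2 then b.coord 2 else 0
  have f0 : f i0 = b.coord 0 := by simp [f]
  have f1 : f i1 = b.coord 1 := by simp [f, h01.symm]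
  have f2 : f i2 = b.coord 2 := by simp [f, h02.symm, h12.symm]
  have fn : ∀ i, i ∉ vset (i0, i1, i2) → f i = 0 := by
    intro i hi
    simp [vset] at hi
    simp [f, hi]
  have hsum : ∀ {M : Type} [AddCommMonoid M] (g : ι → M), (∀ i, i ∉ vset (i0, i1, i2) → g i = 0) →
      ∑ i, g i = g i0 + g i1 + g i2 := by
    intro M _ g hg
    rw [← Finset.sum_subset (Finset.subset_univ (vset (i0, i1, i2))) (fun x _ hx => hg x hx)]
    simp only [vset]
    rw [Finset.sum_insert (by simp [h01, h02]), Finset.sum_insert (by simp [h12]),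
      Finset.sum_singleton, add_assoc]
  refine ⟨f, fn, ?_, ?_, ?_, ?_⟩
  · intro p
    rw [hsum (fun i => f i p) (fun i hi => by simp [fn i hi])]
    have := b.sum_coord_apply_eq_one p
    rw [Fin.sum_univ_three] at this
    simpa [f0, f1, f2] using this
  · intro p
    rw [hsum (fun i => f i p • D.pos i) (fun i hi => by simp [fn i hi])]
    have := b.linear_combination_coord_eq_self p
    rw [Fin.sum_univ_three, hb0, hb1, hb2] at this
    simpa only [f0, f1, f2] using this
  · intro p
    have hr : Set.range b = {D.pos i0, D.pos i1, D.pos i2} := by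
      ext q
      simp [Fin.exists_fin_succ, hb0, hb1, hb2, eq_comm]
    have := b.convexHull_eq_nonneg_coord
    rw [hr] at this
    simp only [triSet]
    rw [this]
    simp only [Set.mem_ofPred_eq, Fin.forall_fin_succ]
    constructor
    · rintro ⟨a0, a1, a2, -⟩ i
      by_cases h0 : i = i0
      · subst h0; rw [f0]; exact a0
      by_cases h1 : i = i1
      · subst h1; rw [f1]; exact a1
      by_cases h2 : i = i2
      · subst h2; rw [f2]; exact a2
      rw [fn i (by simp [vset, h0, h1, h2])]; simp
    · intro h
      refine ⟨by simpa [f0] using h i0, by simpa [f1] using h i1, by simpa [f2] using h i2, fun i => i.elim0⟩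
  · intro i j hj
    simp only [vset, Finset.mem_insert, Finset.mem_singleton] at hj
    by_cases hi : i ∈ vset (i0, i1, i2)
    · simp only [vset, Finset.mem_insert, Finset.mem_singleton] at hi
      have e0 : ∀ k, b.coord k (D.pos i0) = if k = 0 then 1 else 0 := fun k => by
        rw [← hb0, b.coord_apply]
      have e1 : ∀ k, b.coord k (D.pos i1) = if k = 1 then 1 else 0 := fun k => by
        rw [← hb1, b.coord_apply]
      have e2 : ∀ k, b.coord k (D.pos i2) = if k = 2 then 1 else 0 := fun k => by
        rw [← hb2, b.coord_apply]
      rcases hi with rfl | rfl | rfl <;> rcases hj with rfl | rfl | rfl <;>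
        simp_all <;> exact fun h => by simp_all
    · rw [fn i hi]
      have : i ≠ j := by
        rintro rfl; exact hi (by simpa [vset] using hj)
      simp [this]

/-- Barycentric coordinate of the triangle `t` at the vertex `i`. -/
noncomputable def bc (D : TriDisk ι) (t : ι × ι × ι) : ι → ((ℝ × ℝ) →ᵃ[ℝ] ℝ) :=
  open Classical in
  if h : t ∈ D.tris then (exists_bc D t h).choose else 0

section
variable (D : TriDisk ι) {t : ι × ι × ι} (ht : t ∈ D.tris)

lemma bc_spec (D : TriDisk ι) {t : ι × ι × ι} (ht : t ∈ D.tris) :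
      (∀ i, i ∉ vset t → D.bc t i = 0) ∧
      (∀ p, ∑ i, D.bc t i p = 1) ∧
      (∀ p, ∑ i, D.bc t i p • D.pos i = p) ∧
      (∀ p, p ∈ triSet D.pos t ↔ ∀ i, 0 ≤ D.bc t i p) ∧
      (∀ i, ∀ j ∈ vset t, D.bc t i (D.pos j) = if i = j then 1 else 0) := by
  have := (exists_bc D t ht).choose_spec
  simpa only [bc, ht, dif_pos] using this

lemma bc_out (D : TriDisk ι) {t : ι × ι × ι} (ht : t ∈ D.tris) {i : ι} (hi : i ∉ vset t) :
    D.bc t i = 0 := (bc_spec D ht).1 i hi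
lemma bc_sum (D : TriDisk ι) {t : ι × ι × ι} (ht : t ∈ D.tris) (p : ℝ × ℝ) :
    ∑ i, D.bc t i p = 1 := (bc_spec D ht).2.1 p
lemma bc_comb (D : TriDisk ι) {t : ι × ι × ι} (ht : t ∈ D.tris) (p : ℝ × ℝ) :
    ∑ i, D.bc t i p • D.pos i = p := (bc_spec D ht).2.2.1 p
lemma bc_mem (D : TriDisk ι) {t : ι × ι × ι} (ht : t ∈ D.tris) (p : ℝ × ℝ) :
    p ∈ triSet D.pos t ↔ ∀ i, 0 ≤ D.bc t i p := (bc_spec D ht).2.2.2.1 p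
lemma bc_vert (D : TriDisk ι) {t : ι × ι × ι} (ht : t ∈ D.tris) (i : ι) {j : ι}
    (hj : j ∈ vset t) : D.bc t i (D.pos j) = if i = j then 1 else 0 :=
  (bc_spec D ht).2.2.2.2 i j hj

lemma bc_unique (D : TriDisk ι) {t : ι × ι × ι} (ht : t ∈ D.tris) (w : ι → ℝ)
    (hw : ∀ i, i ∉ vset t → w i = 0) (h1 : ∑ i, w i = 1) (i : ι) :
    D.bc t i (∑ j, w j • D.pos j) = w i := by
  rw [aff_sum _ _ _ h1]
  rw [Finset.sum_eq_single i]
  · by_cases hi : i ∈ vset t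
    · simp [bc_vert D ht i hi]
    · simp [hw i hi]
  · intro j _ hj
    by_cases hi : j ∈ vset t
    · rw [bc_vert D ht i hi, if_neg (Ne.symm hj), mul_zero]
    · simp [hw j hi]
  · simp

lemma bc_cont (D : TriDisk ι) (t : ι × ι × ι) (i : ι) : Continuous (D.bc t i) :=
  AffineMap.continuous_of_finiteDimensional _

lemma tri_closed (D : TriDisk ι) {t : ι × ι × ι} (ht : t ∈ D.tris) :
    IsClosed (triSet D.pos t) := by
  have : triSet D.pos t = ⋂ i, {p | 0 ≤ D.bc t i p} := by
    ext p; simp [bc_mem D ht]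
  rw [this]
  exact isClosed_iInter fun i => isClosed_le continuous_const (bc_cont D t i)

lemma tri_compact (D : TriDisk ι) (t : ι × ι × ι) : IsCompact (triSet D.pos t) :=
  (Set.toFinite _).isCompact_convexHull (𝕜 := ℝ)

lemma vert_mem (D : TriDisk ι) {t : ι × ι × ι} {j : ι} (hj : j ∈ vset t) :
    D.pos j ∈ triSet D.pos t := by
  apply subset_convexHull
  simp only [vset, Finset.mem_insert, Finset.mem_singleton] at hj
  rcases hj with rfl | rfl | rfl <;> simp

lemma mem_space (D : TriDisk ι) {p : ℝ × ℝ} : p ∈ D.space ↔ ∃ t ∈ D.tris, p ∈ triSet D.pos t := by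
  simp [space]

lemma tri_sub (D : TriDisk ι) {t : ι × ι × ι} (ht : t ∈ D.tris) : triSet D.pos t ⊆ D.space :=
  fun _ hp => (mem_space D).2 ⟨t, ht, hp⟩

lemma space_compact (D : TriDisk ι) : IsCompact D.space :=
  D.tris.isCompact_biUnion fun t _ => tri_compact D t

lemma bc_agree (D : TriDisk ι) {s t : ι × ι × ι} (hs : s ∈ D.tris) (ht : t ∈ D.tris) {p : ℝ × ℝ}
    (hps : p ∈ triSet D.pos s) (hpt : p ∈ triSet D.pos t) (i : ι) : D.bc s i p = D.bc t i p := by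
  have hp : p ∈ convexHull ℝ (D.pos '' ((vset s ∩ vset t : Finset ι) : Set ι)) := by
    rw [← D.glue s hs t ht]; exact ⟨hps, hpt⟩
  have : ∃ w : ι → ℝ, (∀ i, i ∉ vset s ∩ vset t → w i = 0) ∧ ∑ i, w i = 1 ∧
      ∑ i, w i • D.pos i = p := by
    have hp' : p ∈ convexHull ℝ (((vset s ∩ vset t).image D.pos : Finset (ℝ × ℝ)) : Set (ℝ × ℝ)) := by
      simpa using hp
    rw [Finset.mem_convexHull'] at hp'
    obtain ⟨w, -, h1, h2⟩ := hp'
    rw [Finset.sum_image (fun a _ b _ h => D.inj h)] at h1 h2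
    refine ⟨fun i => if i ∈ vset s ∩ vset t then w (D.pos i) else 0, ?_, ?_, ?_⟩
    · intro i hi; simp only [hi, if_false]
    · rw [← h1, ← Finset.sum_filter]; congr 1; ext; simp
    · simp_rw [ite_smul, zero_smul]
      rw [← h2, ← Finset.sum_filter]; congr 1; ext; simp
  obtain ⟨w, w0, w1, w2⟩ := this
  rw [← w2, bc_unique D hs w (fun i hi => w0 i (by simp [hi])) w1,
    bc_unique D ht w (fun i hi => w0 i (by simp [hi])) w1]

/-- The hat function of the vertex `i`. -/
noncomputable def hat (D : TriDisk ι) (i : ι) (p : ℝ × ℝ) : ℝ :=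
  open Classical in
  if h : ∃ t ∈ D.tris, p ∈ triSet D.pos t then D.bc h.choose i p else 0

lemma hat_eq (D : TriDisk ι) {t : ι × ι × ι} (ht : t ∈ D.tris) {p : ℝ × ℝ}
    (hp : p ∈ triSet D.pos t) (i : ι) : D.hat i p = D.bc t i p := by
  have h : ∃ t ∈ D.tris, p ∈ triSet D.pos t := ⟨t, ht, hp⟩
  rw [hat, dif_pos h]
  exact bc_agree D h.choose_spec.1 ht h.choose_spec.2 hp i

lemma hat_nonneg (D : TriDisk ι) {p : ℝ × ℝ} (hp : p ∈ D.space) (i : ι) : 0 ≤ D.hat i p := by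
  obtain ⟨t, ht, h⟩ := (mem_space D).1 hp
  rw [hat_eq D ht h]; exact (bc_mem D ht p).1 h i

lemma hat_sum (D : TriDisk ι) {p : ℝ × ℝ} (hp : p ∈ D.space) : ∑ i, D.hat i p = 1 := by
  obtain ⟨t, ht, h⟩ := (mem_space D).1 hp
  simp_rw [hat_eq D ht h]; exact bc_sum D ht p

lemma hat_comb (D : TriDisk ι) {p : ℝ × ℝ} (hp : p ∈ D.space) :
    ∑ i, D.hat i p • D.pos i = p := by
  obtain ⟨t, ht, h⟩ := (mem_space D).1 hp
  simp_rw [hat_eq D ht h]; exact bc_comb D ht p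

lemma hat_pos_mem (D : TriDisk ι) {t : ι × ι × ι} (ht : t ∈ D.tris) {p : ℝ × ℝ}
    (hp : p ∈ triSet D.pos t) {i : ι} (hi : D.hat i p ≠ 0) : i ∈ vset t := by
  by_contra h
  rw [hat_eq D ht hp, bc_out D ht h] at hi
  simp at hi

lemma hat_vert (D : TriDisk ι) {t : ι × ι × ι} (ht : t ∈ D.tris) (i : ι) {j : ι}
    (hj : j ∈ vset t) : D.hat i (D.pos j) = if i = j then 1 else 0 := by
  rw [hat_eq D ht (vert_mem D hj), bc_vert D ht i hj]

lemma contOn_space (D : TriDisk ι) {Y : Type*} [TopologicalSpace Y] {f : ℝ × ℝ → Y}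
    (h : ∀ t ∈ D.tris, ContinuousOn f (triSet D.pos t)) : ContinuousOn f D.space := by
  have : D.space = ⋃ t : D.tris, triSet D.pos t := by
    simp [space, Set.iUnion_subtype]
  rw [this]
  exact (locallyFinite_of_finite _).continuousOn_iUnion (fun t => tri_closed D t.2)
    (fun t => h t t.2)

lemma hat_cont (D : TriDisk ι) (i : ι) : ContinuousOn (D.hat i) D.space := by
  apply contOn_space
  intro t ht
  exact (bc_cont D t i).continuousOn.congr fun p hp => hat_eq D ht hp i

/-- Piecewise linear extension of vertex values `u`. -/
noncomputable def ext (D : TriDisk ι) (u : ι → ℝ) (p : ℝ × ℝ) : ℝ := ∑ i, u i * D.hat i p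

/-- Affine extension of vertex values on a triangle. -/
noncomputable def aext (D : TriDisk ι) (t : ι × ι × ι) (u : ι → ℝ) : (ℝ × ℝ) →ᵃ[ℝ] ℝ :=
  ∑ i, u i • D.bc t i

lemma aext_apply (D : TriDisk ι) (t : ι × ι × ι) (u : ι → ℝ) (p : ℝ × ℝ) :
    D.aext t u p = ∑ i, u i * D.bc t i p := by
  have : ∀ s : Finset ι, (∑ i ∈ s, u i • D.bc t i) p = ∑ i ∈ s, u i * D.bc t i p := by
    intro s
    induction s using Finset.induction_on with
    | empty => simp
    | insert a s ha ih => rw [Finset.sum_insert ha, Finset.sum_insert ha]; simp [ih]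
  exact this _

lemma ext_eq (D : TriDisk ι) {t : ι × ι × ι} (ht : t ∈ D.tris) {p : ℝ × ℝ}
    (hp : p ∈ triSet D.pos t) (u : ι → ℝ) : D.ext u p = D.aext t u p := by
  rw [aext_apply]; simp_rw [ext, hat_eq D ht hp]

lemma ext_cont (D : TriDisk ι) (u : ι → ℝ) : ContinuousOn (D.ext u) D.space := by
  unfold ext
  exact continuousOn_finsetSum _ fun i _ => continuousOn_const.mul (hat_cont D i)

lemma ext_vert (D : TriDisk ι) {t : ι × ι × ι} (ht : t ∈ D.tris) {j : ι}
    (hj : j ∈ vset t) (u : ι → ℝ) : D.ext u (D.pos j) = u j := by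
  simp [ext, hat_vert D ht _ hj]

lemma ext_lin (D : TriDisk ι) (u w : ι → ℝ) (a b : ℝ) (p : ℝ × ℝ) :
    D.ext (fun i => a * u i + b * w i) p = a * D.ext u p + b * D.ext w p := by
  simp only [ext, Finset.mul_sum, ← Finset.sum_add_distrib]
  exact Finset.sum_congr rfl fun i _ => by ring

lemma ext_x (D : TriDisk ι) {p : ℝ × ℝ} (hp : p ∈ D.space) :
    D.ext (fun i => (D.pos i).1) p = p.1 := by
  have := congrArg Prod.fst (hat_comb D hp)
  rw [Prod.fst_sum] at this
  rw [← this, ext]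
  exact Finset.sum_congr rfl fun i _ => by simp [mul_comm]

lemma ext_y (D : TriDisk ι) {p : ℝ × ℝ} (hp : p ∈ D.space) :
    D.ext (fun i => (D.pos i).2) p = p.2 := by
  have := congrArg Prod.snd (hat_comb D hp)
  rw [Prod.snd_sum] at this
  rw [← this, ext]
  exact Finset.sum_congr rfl fun i _ => by simp [mul_comm]

lemma ext_const (D : TriDisk ι) {p : ℝ × ℝ} (hp : p ∈ D.space) (c : ℝ) :
    D.ext (fun _ => c) p = c := by
  simp [ext, ← Finset.mul_sum, hat_sum D hp]

end
end TriDisk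

namespace TriDisk

set_option linter.unusedSectionVars false
variable {ι : Type} [Fintype ι] [DecidableEq ι]
open Filter Topology

lemma aff_decomp (f : (ℝ × ℝ) →ᵃ[ℝ] ℝ) (p : ℝ × ℝ) : f p = f.linear p + f 0 := by
  have := congrFun (AffineMap.decomp f) p
  simpa using this

lemma aff_combo (f : (ℝ × ℝ) →ᵃ[ℝ] ℝ) {a b : ℝ} (h : a + b = 1) (p q : ℝ × ℝ) :
    f (a • p + b • q) = a * f p + b * f q := by
  rw [aff_decomp f, aff_decomp f p, aff_decomp f q]
  simp only [map_add, map_smul, smul_eq_mul]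
  have : b = 1 - a := by linarith
  subst this; ring

lemma aff_ray (f : (ℝ × ℝ) →ᵃ[ℝ] ℝ) (p d : ℝ × ℝ) (r : ℝ) :
    f (p + r • d) = f p + r * f.linear d := by
  rw [aff_decomp f, aff_decomp f p]
  simp only [map_add, map_smul, smul_eq_mul]
  ring

lemma ray_tri (D : TriDisk ι) (q d : ℝ × ℝ) (h : ∃ᶠ r in 𝓝[>] (0 : ℝ), q + r • d ∈ D.space) :
    ∃ t ∈ D.tris, ∃ r0 > (0:ℝ), ∀ r : ℝ, 0 ≤ r → r ≤ r0 → q + r • d ∈ triSet D.pos t := by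
  have h' : ∃ t ∈ D.tris, ∃ᶠ r in 𝓝[>] (0 : ℝ), q + r • d ∈ triSet D.pos t := by
    by_contra hc
    push Not at hc
    apply h
    have := (eventually_all_finset D.tris).2 hc
    filter_upwards [this] with r hr hS
    obtain ⟨t, ht, hp⟩ := (mem_space D).1 hS
    exact hr t ht hp
  obtain ⟨t, ht, hf⟩ := h'
  have hq : q ∈ triSet D.pos t := by
    have ht' : Tendsto (fun r : ℝ => q + r • d) (𝓝[>] 0) (𝓝 q) := by
      have : Continuous (fun r : ℝ => q + r • d) := by fun_prop
      have := (this.tendsto 0).mono_left (nhdsWithin_le_nhds (s := Set.Ioi 0))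
      simpa using this
    exact (tri_closed D ht).mem_of_frequently_of_tendsto hf ht'
  obtain ⟨r0, hr0, hpos⟩ := (hf.and_eventually self_mem_nhdsWithin).exists
  refine ⟨t, ht, r0, hpos, fun r h0 h1 => ?_⟩
  have hpos' : 0 < r0 := hpos
  have hconv : Convex ℝ (triSet D.pos t) := convex_convexHull _ _
  have := hconv.add_smul_mem hq hr0 (t := r / r0) ⟨by positivity, by rw [div_le_one hpos']; exact h1⟩
  rwa [smul_smul, div_mul_cancel₀ _ hpos'.ne'] at this

/-- Vertical slope of the affine extension of `u` on `t`. -/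
noncomputable def slope (D : TriDisk ι) (t : ι × ι × ι) (u : ι → ℝ) : ℝ :=
  (D.aext t u).linear (0, 1)

lemma slope_eq (D : TriDisk ι) (t : ι × ι × ι) (u : ι → ℝ) :
    D.slope t u = ∑ i, u i * (D.bc t i (0, 1) - D.bc t i 0) := by
  have := aff_decomp (D.aext t u) (0, 1)
  rw [slope, show (D.aext t u).linear (0,1) = D.aext t u (0,1) - D.aext t u 0 by rw [this]; ring,
    aext_apply, aext_apply, ← Finset.sum_sub_distrib]
  exact Finset.sum_congr rfl fun i _ => by ring

lemma slope_lin (D : TriDisk ι) (t : ι × ι × ι) (u w : ι → ℝ) (a b : ℝ) :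
    D.slope t (fun i => a * u i + b * w i) = a * D.slope t u + b * D.slope t w := by
  simp only [slope_eq, Finset.mul_sum, ← Finset.sum_add_distrib]
  exact Finset.sum_congr rfl fun i _ => by ring

lemma slope_y (D : TriDisk ι) {t : ι × ι × ι} (ht : t ∈ D.tris) :
    D.slope t (fun i => (D.pos i).2) = 1 := by
  have h1 := congrArg Prod.snd (bc_comb D ht (0, 1))
  have h0 := congrArg Prod.snd (bc_comb D ht 0)
  rw [Prod.snd_sum] at h1 h0
  simp only [Prod.smul_snd, smul_eq_mul, Prod.snd_zero] at h1 h0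
  rw [slope_eq]
  simp_rw [mul_sub, Finset.sum_sub_distrib, mul_comm (D.pos _).2, h1, h0]
  norm_num

lemma slope_x (D : TriDisk ι) {t : ι × ι × ι} (ht : t ∈ D.tris) :
    D.slope t (fun i => (D.pos i).1) = 0 := by
  have h1 := congrArg Prod.fst (bc_comb D ht (0, 1))
  have h0 := congrArg Prod.fst (bc_comb D ht 0)
  rw [Prod.fst_sum] at h1 h0
  simp only [Prod.smul_fst, smul_eq_mul, Prod.fst_zero] at h1 h0
  rw [slope_eq]
  simp_rw [mul_sub, Finset.sum_sub_distrib, mul_comm (D.pos _).1, h1, h0]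
  norm_num

lemma slope_const (D : TriDisk ι) {t : ι × ι × ι} (ht : t ∈ D.tris) (c : ℝ) :
    D.slope t (fun _ => c) = 0 := by
  rw [slope_eq, ← Finset.mul_sum, Finset.sum_sub_distrib, bc_sum D ht, bc_sum D ht]; simp

lemma slice_mem (D : TriDisk ι) (hT : D.TrV) {p q r : ℝ × ℝ} (hp : p ∈ D.space) (hq : q ∈ D.space)
    (hpq : p.1 = r.1) (hqr : q.1 = r.1) (h1 : p.2 ≤ r.2) (h2 : r.2 ≤ q.2) : r ∈ D.space := by
  have h := (hT r.1).image Prod.snd continuous_snd.continuousOn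
  have := h.ordConnected.out (Set.mem_image_of_mem _ ⟨hp, hpq⟩) (Set.mem_image_of_mem _ ⟨hq, hqr⟩)
    ⟨h1, h2⟩
  obtain ⟨s, ⟨hs, hs1⟩, hs2⟩ := this
  have : s = r := Prod.ext hs1 hs2
  rwa [← this]

lemma mono_slice (D : TriDisk ι) (hT : D.TrV) (u : ι → ℝ) (κ : ℝ)
    (hk : ∀ t ∈ D.tris, κ ≤ D.slope t u) {p q : ℝ × ℝ} (hp : p ∈ D.space) (hq : q ∈ D.space)
    (h1 : p.1 = q.1) (h2 : p.2 ≤ q.2) : κ * (q.2 - p.2) ≤ D.ext u q - D.ext u p := by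
  obtain ⟨c, y0⟩ := p
  obtain ⟨c', y1⟩ := q
  simp only at h1 h2
  subst h1
  have hmem : ∀ y ∈ Set.Icc y0 y1, (c, y) ∈ D.space := fun y hy =>
    slice_mem D hT hp hq rfl rfl hy.1 hy.2
  have hcont : ContinuousOn (fun y => D.ext u (c, y)) (Set.Icc y0 y1) :=
    (ext_cont D u).comp (by fun_prop) hmem
  let s : Set ℝ := {y | y ∈ Set.Icc y0 y1 ∧ κ * (y - y0) ≤ D.ext u (c, y) - D.ext u (c, y0)}
  have hs : IsClosed s := isClosed_Icc.isClosed_le (by fun_prop) (hcont.sub continuousOn_const)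
  have hsub : Set.Icc y0 y1 ⊆ s := by
    apply IsClosed.Icc_subset_of_forall_exists_gt (hs.inter isClosed_Icc)
    · exact ⟨⟨le_rfl, h2⟩, by simp⟩
    · rintro x ⟨⟨hx, hx'⟩, hxl, hxr⟩ y hy
      have hy : x < y := hy
      obtain ⟨t, ht, r0, hr0, hr⟩ := ray_tri D (c, x) (0, 1) (by
        apply Eventually.frequently
        filter_upwards [Ioo_mem_nhdsGT (sub_pos.2 hxr)] with r hr
        have := hmem (x + r) ⟨by linarith [hr.1], by linarith [hr.2]⟩
        simpa using this)
      let δ := min (min r0 (y - x)) (y1 - x)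
      have hδ : 0 < δ := lt_min (lt_min hr0 (sub_pos.2 hy)) (sub_pos.2 hxr)
      have hδ1 : δ ≤ r0 := (min_le_left _ _).trans (min_le_left _ _)
      have hδ2 : δ ≤ y - x := (min_le_left _ _).trans (min_le_right _ _)
      have hδ3 : δ ≤ y1 - x := min_le_right _ _
      have hm0 := hr 0 le_rfl hr0.le
      have hm1 := hr δ hδ.le hδ1
      have e := aff_ray (D.aext t u) (c, x) (0, 1) δ
      rw [← ext_eq D ht hm1, ← ext_eq D ht (by simpa using hm0)] at e
      have hkt := hk t ht
      rw [slope] at hkt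
      refine ⟨x + δ, ⟨⟨by linarith, by linarith⟩, ?_⟩, by linarith, by linarith⟩
      have e' : D.ext u (c, x + δ) = D.ext u (c, x) + δ * (D.aext t u).linear (0, 1) := by
        rw [← e]; simp
      rw [e']
      nlinarith
  exact (hsub ⟨h2, le_rfl⟩).2

lemma vset_card (D : TriDisk ι) {t : ι × ι × ι} (ht : t ∈ D.tris) : (vset t).card = 3 := by
  have hi := (D.indep t ht).injective
  have h01 : t.1 ≠ t.2.1 := fun h => by
    have := hi.ne (show (0 : Fin 3) ≠ 1 by decide)
    exact this (by simp [h])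
  have h02 : t.1 ≠ t.2.2 := fun h => by
    have := hi.ne (show (0 : Fin 3) ≠ 2 by decide)
    exact this (by simp [h])
  have h12 : t.2.1 ≠ t.2.2 := fun h => by
    have := hi.ne (show (1 : Fin 3) ≠ 2 by decide)
    exact this (by simp [h])
  rw [vset, Finset.card_eq_three]
  exact ⟨_, _, _, h01, h02, h12, rfl⟩

lemma vset_third (D : TriDisk ι) {t : ι × ι × ι} (ht : t ∈ D.tris) {a b : ι} (ha : a ∈ vset t)
    (hb : b ∈ vset t) (hab : a ≠ b) : ∃ k ∈ vset t, k ≠ a ∧ k ≠ b ∧ ∀ i ∈ vset t, i = a ∨ i = b ∨ i = k := by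
  have h1 : (((vset t).erase a).erase b).card = 1 := by
    rw [Finset.card_erase_of_mem (by simp [hb, hab.symm]), Finset.card_erase_of_mem ha, vset_card D ht]
  obtain ⟨k, hk⟩ := Finset.card_eq_one.1 h1
  have hk' : k ∈ ((vset t).erase a).erase b := by rw [hk]; simp
  simp only [Finset.mem_erase] at hk'
  refine ⟨k, hk'.2.2, hk'.2.1, hk'.1, fun i hi => ?_⟩
  by_contra hc
  push Not at hc
  have : i ∈ ((vset t).erase a).erase b := by simp [hc, hi]
  rw [hk] at this
  exact hc.2.2 (by simpa using this)

lemma interior_of_pos (D : TriDisk ι) {t : ι × ι × ι} (ht : t ∈ D.tris) {p : ℝ × ℝ}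
    (hp : ∀ i ∈ vset t, 0 < D.bc t i p) : p ∈ interior (triSet D.pos t) := by
  rw [mem_interior_iff_mem_nhds]
  have : ∀ᶠ q in 𝓝 p, ∀ i ∈ vset t, 0 < D.bc t i q := by
    rw [eventually_all_finset]
    intro i hi
    exact (bc_cont D t i).continuousAt.eventually (lt_mem_nhds (hp i hi))
  filter_upwards [this] with q hq
  rw [bc_mem D ht]
  intro i
  by_cases h : i ∈ vset t
  · exact (hq i h).le
  · rw [bc_out D ht h]; simp

lemma bc_seg (D : TriDisk ι) {t : ι × ι × ι} (ht : t ∈ D.tris) {a b : ι} (ha : a ∈ vset t)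
    (hb : b ∈ vset t) {r s : ℝ} (hrs : r + s = 1) (i : ι) :
    D.bc t i (r • D.pos a + s • D.pos b) = r * (if i = a then 1 else 0) + s * (if i = b then 1 else 0) := by
  rw [aff_combo _ hrs, bc_vert D ht i ha, bc_vert D ht i hb]

lemma seg_tri (D : TriDisk ι) {t : ι × ι × ι} {a b : ι} (ha : a ∈ vset t)
    (hb : b ∈ vset t) : segment ℝ (D.pos a) (D.pos b) ⊆ triSet D.pos t :=
  (convex_convexHull _ _).segment_subset (vert_mem D ha) (vert_mem D hb)

lemma hat_seg (D : TriDisk ι) {t : ι × ι × ι} (ht : t ∈ D.tris) {a b : ι} (ha : a ∈ vset t)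
    (hb : b ∈ vset t) (hab : a ≠ b) {p : ℝ × ℝ} (hp : p ∈ openSegment ℝ (D.pos a) (D.pos b)) :
    0 < D.hat a p ∧ 0 < D.hat b p ∧ ∀ i, i ≠ a → i ≠ b → D.hat i p = 0 := by
  have hpt := seg_tri D ha hb (openSegment_subset_segment ℝ _ _ hp)
  obtain ⟨r, s, hr, hs, hrs, rfl⟩ := hp
  simp only [hat_eq D ht hpt, bc_seg D ht ha hb hrs]
  refine ⟨by simp [hab, hr], by simp [hab.symm, hs], fun i h1 h2 => by simp [h1, h2]⟩

lemma edge_interior (D : TriDisk ι) {t : ι × ι × ι} (ht : t ∈ D.tris) {a b : ι} (ha : a ∈ vset t)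
    (hb : b ∈ vset t) (hab : a ≠ b) {p : ℝ × ℝ} (hp : p ∈ openSegment ℝ (D.pos a) (D.pos b))
    (hpi : p ∈ interior D.space) :
    openSegment ℝ (D.pos a) (D.pos b) ⊆ interior D.space := by
  obtain ⟨k, hk, hka, hkb, hall⟩ := vset_third D ht ha hb hab
  have hpS := interior_subset hpi
  obtain ⟨hpa, hpb, hp0⟩ := hat_seg D ht ha hb hab hp
  have hpt := seg_tri D ha hb (openSegment_subset_segment ℝ _ _ hp)
  -- a nearby point on the other side
  have htend : Tendsto (fun r : ℝ => p + r • (p - D.pos k)) (𝓝[>] 0) (𝓝 p) := by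
    have : Continuous (fun r : ℝ => p + r • (p - D.pos k)) := by fun_prop
    have := (this.tendsto 0).mono_left (nhdsWithin_le_nhds (s := Set.Ioi 0))
    simpa using this
  have hS : ∀ᶠ q in 𝓝 p, q ∈ D.space := mem_interior_iff_mem_nhds.1 hpi
  have hca : ∀ᶠ q in 𝓝 p, 0 < D.hat a q :=
    ((hat_cont D a).continuousAt hS).eventually (lt_mem_nhds hpa)
  have hcb : ∀ᶠ q in 𝓝 p, 0 < D.hat b q :=
    ((hat_cont D b).continuousAt hS).eventually (lt_mem_nhds hpb)
  obtain ⟨r, ⟨hrS, hra, hrb⟩, hr⟩ := ((htend.eventually (hS.and (hca.and hcb))).and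
    self_mem_nhdsWithin).exists
  have hr : 0 < r := hr
  set q := p + r • (p - D.pos k) with hq
  have hqk : D.bc t k q = -r := by
    have e : q = (1 + r) • p + (-r) • D.pos k := by rw [hq]; module
    have e2 : D.bc t k p = 0 := by rw [← hat_eq D ht hpt]; exact hp0 k hka hkb
    rw [e, aff_combo _ (by ring), e2, bc_vert D ht k hk]
    simp
  obtain ⟨t', ht', hqt'⟩ := (mem_space D).1 hrS
  have ha' := hat_pos_mem D ht' hqt' hra.ne'
  have hb' := hat_pos_mem D ht' hqt' hrb.ne'
  obtain ⟨k', hk', hka', hkb', hall'⟩ := vset_third D ht' ha' hb' hab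
  have key : ∀ z, D.bc t k z = D.bc t' k' z * D.bc t k (D.pos k') := by
    intro z
    conv_lhs => rw [← bc_comb D ht' z]
    rw [aff_sum _ _ _ (bc_sum D ht' z), Finset.sum_eq_single k']
    · intro i _ hi
      by_cases hi' : i ∈ vset t'
      · rcases hall' i hi' with rfl | rfl | rfl
        · rw [bc_vert D ht k ha, if_neg hka, mul_zero]
        · rw [bc_vert D ht k hb, if_neg hkb, mul_zero]
        · exact absurd rfl hi
      · rw [bc_out D ht' hi']; simp
    · simp
  have hneg : D.bc t k (D.pos k') < 0 := by
    have h1 := key q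
    have h2 := (bc_mem D ht' q).1 hqt' k'
    rw [hqk] at h1
    nlinarith
  intro p' hp'
  obtain ⟨hpa', hpb', hp0'⟩ := hat_seg D ht ha hb hab hp'
  have hpt1 := seg_tri D ha hb (openSegment_subset_segment ℝ _ _ hp')
  have hpt2 := seg_tri D ha' hb' (openSegment_subset_segment ℝ _ _ hp')
  rw [mem_interior_iff_mem_nhds]
  have c1 : ∀ᶠ z in 𝓝 p', 0 < D.bc t a z :=
    (bc_cont D t a).continuousAt.eventually (lt_mem_nhds (by rwa [← hat_eq D ht hpt1]))
  have c2 : ∀ᶠ z in 𝓝 p', 0 < D.bc t b z :=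
    (bc_cont D t b).continuousAt.eventually (lt_mem_nhds (by rwa [← hat_eq D ht hpt1]))
  have c3 : ∀ᶠ z in 𝓝 p', 0 < D.bc t' a z :=
    (bc_cont D t' a).continuousAt.eventually (lt_mem_nhds (by rwa [← hat_eq D ht' hpt2]))
  have c4 : ∀ᶠ z in 𝓝 p', 0 < D.bc t' b z :=
    (bc_cont D t' b).continuousAt.eventually (lt_mem_nhds (by rwa [← hat_eq D ht' hpt2]))
  filter_upwards [c1, c2, c3, c4] with z h1 h2 h3 h4
  rcases le_or_gt 0 (D.bc t k z) with h5 | h5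
  · apply tri_sub D ht
    rw [bc_mem D ht]
    intro i
    by_cases hi : i ∈ vset t
    · rcases hall i hi with rfl | rfl | rfl
      exacts [h1.le, h2.le, h5]
    · rw [bc_out D ht hi]; simp
  · apply tri_sub D ht'
    rw [bc_mem D ht']
    intro i
    by_cases hi : i ∈ vset t'
    · rcases hall' i hi with rfl | rfl | rfl
      · exact h3.le
      · exact h4.le
      · rw [key z] at h5
        by_contra hc
        push Not at hc
        nlinarith
    · rw [bc_out D ht' hi]; simp

lemma frontier_eq (D : TriDisk ι) : frontier D.space = D.space \ interior D.space :=
  (space_compact D).isClosed.frontier_eq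

lemma edge_boundary (D : TriDisk ι) {t : ι × ι × ι} (ht : t ∈ D.tris) {a b : ι} (ha : a ∈ vset t)
    (hb : b ∈ vset t) (hab : a ≠ b) {p : ℝ × ℝ} (hp : p ∈ openSegment ℝ (D.pos a) (D.pos b))
    (hpi : p ∈ frontier D.space) : D.IsBoundaryEdge a b := by
  refine ⟨⟨hab, t, ht, ha, hb⟩, ?_⟩
  have h : openSegment ℝ (D.pos a) (D.pos b) ⊆ frontier D.space := by
    intro q hq
    rw [frontier_eq]
    refine ⟨tri_sub D ht (seg_tri D ha hb (openSegment_subset_segment ℝ _ _ hq)), fun hqi => ?_⟩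
    rw [frontier_eq] at hpi
    exact hpi.2 (edge_interior D ht ha hb hab hq hqi hp)
  rw [← closure_openSegment]
  exact closure_minimal h isClosed_frontier

/-- A point of a triangle is a vertex, in an open edge, or interior. -/
lemma tri_cases (D : TriDisk ι) {t : ι × ι × ι} (ht : t ∈ D.tris) {p : ℝ × ℝ}
    (hp : p ∈ triSet D.pos t) : (∃ i ∈ vset t, p = D.pos i) ∨
    (∃ a ∈ vset t, ∃ b ∈ vset t, a ≠ b ∧ p ∈ openSegment ℝ (D.pos a) (D.pos b)) ∨
    p ∈ interior (triSet D.pos t) := by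
  by_cases hall : ∀ i ∈ vset t, 0 < D.bc t i p
  · exact Or.inr (Or.inr (interior_of_pos D ht hall))
  push Not at hall
  obtain ⟨k, hk, hk0⟩ := hall
  have hnn := (bc_mem D ht p).1 hp
  have hk0 : D.bc t k p = 0 := le_antisymm hk0 (hnn k)
  have : ∃ a ∈ vset t, a ≠ k := by
    have h := vset_card D ht
    obtain ⟨a, ha, hak⟩ := Finset.exists_mem_ne (by omega : 1 < (vset t).card) k
    exact ⟨a, ha, hak⟩
  obtain ⟨a, ha, hak⟩ := this
  obtain ⟨b, hb, hba, hbk, hall⟩ := vset_third D ht ha hk hak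
  have hsum := bc_sum D ht p
  have hcomb := bc_comb D ht p
  have hz : ∀ i, i ∉ ({a, b} : Finset ι) → D.bc t i p = 0 := by
    intro i hi
    simp at hi
    by_cases h : i ∈ vset t
    · rcases hall i h with rfl | rfl | rfl
      exacts [absurd rfl hi.1, hk0, absurd rfl hi.2]
    · rw [bc_out D ht h]; simp
  rw [← Finset.sum_subset (Finset.subset_univ {a, b}) (fun i _ hi => hz i hi),
    Finset.sum_pair hba.symm] at hsum
  rw [← Finset.sum_subset (Finset.subset_univ {a, b}) (fun i _ hi => by rw [hz i hi, zero_smul]),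
    Finset.sum_pair hba.symm] at hcomb
  rcases (hnn a).eq_or_lt with h0 | h0
  · left
    refine ⟨b, hb, ?_⟩
    rw [← hcomb, ← h0]
    rw [← h0] at hsum
    have : D.bc t b p = 1 := by linarith
    simp [this]
  rcases (hnn b).eq_or_lt with h1 | h1
  · left
    refine ⟨a, ha, ?_⟩
    rw [← hcomb, ← h1]
    rw [← h1] at hsum
    have : D.bc t a p = 1 := by linarith
    simp [this]
  · exact Or.inr (Or.inl ⟨a, ha, b, hb, hba.symm, _, _, h0, h1, hsum, hcomb⟩)

lemma near_vert (D : TriDisk ι) {t : ι × ι × ι} (ht : t ∈ D.tris) {i : ι} (hi : i ∈ vset t) :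
    ∀ᶠ p in 𝓝[D.space] (D.pos i), 0 < D.hat i p := by
  have h := (hat_cont D i) (D.pos i) (tri_sub D ht (vert_mem D hi))
  refine h.eventually (lt_mem_nhds ?_)
  rw [hat_vert D ht i hi]; simp

end TriDisk

namespace TriDisk

set_option linter.unusedSectionVars false
variable {ι : Type} [Fintype ι] [DecidableEq ι]
open Filter Topology

/-- `p` is the top (`s = 1`) or bottom (`s = -1`) of its vertical slice. -/
def IsTop (D : TriDisk ι) (s : ℝ) (p : ℝ × ℝ) : Prop :=
  p ∈ D.space ∧ ∀ q ∈ D.space, q.1 = p.1 → s * q.2 ≤ s * p.2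

/-- `p` is not on an extreme vertical line. -/
def NonExt (D : TriDisk ι) (p : ℝ × ℝ) : Prop :=
  (∃ q ∈ D.space, q.1 < p.1) ∧ (∃ q ∈ D.space, p.1 < q.1)

/-- The standing hypotheses. -/
structure Hyp (D : TriDisk ι) (v : ℝ × ℝ → ℝ × ℝ) : Prop where
  hT : D.TrV
  hSL : D.SLOnBoundary v
  hinj : Set.InjOn v (frontier D.space)
  hvert : TriDisk.VerticalOn v (frontier D.space)
  hconv : D.ConvexImage v

/-- A sign. -/
def IsSign (s : ℝ) : Prop := s = 1 ∨ s = -1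

lemma IsSign.neg {s : ℝ} (h : IsSign s) : IsSign (-s) := by
  rcases h with rfl | rfl
  · right; rfl
  · left; norm_num

lemma IsSign.sq {s : ℝ} (h : IsSign s) : s * s = 1 := by
  rcases h with rfl | rfl <;> norm_num

lemma int_ray (D : TriDisk ι) {p : ℝ × ℝ} (hp : p ∈ interior D.space) (d : ℝ × ℝ) :
    ∀ᶠ r in 𝓝 (0 : ℝ), p + r • d ∈ interior D.space := by
  have h : Tendsto (fun r : ℝ => p + r • d) (𝓝 0) (𝓝 p) := by
    have : Continuous (fun r : ℝ => p + r • d) := by fun_prop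
    simpa using this.tendsto 0
  exact h.eventually (isOpen_interior.mem_nhds hp)

lemma int_ray' (D : TriDisk ι) {p : ℝ × ℝ} (hp : p ∈ interior D.space) (d : ℝ × ℝ) :
    ∃ r > (0:ℝ), p + r • d ∈ interior D.space := by
  have := ((int_ray D hp d).filter_mono (nhdsWithin_le_nhds (s := Set.Ioi 0))).and
    self_mem_nhdsWithin
  obtain ⟨r, h, hr⟩ := this.exists
  exact ⟨r, hr, h⟩

lemma fr_sub (D : TriDisk ι) {p : ℝ × ℝ} (h : p ∈ frontier D.space) : p ∈ D.space := by
  rw [frontier_eq] at h; exact h.1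

lemma top_frontier (D : TriDisk ι) {s : ℝ} (hs : IsSign s) {p : ℝ × ℝ} (h : D.IsTop s p) :
    p ∈ frontier D.space := by
  rw [frontier_eq]
  refine ⟨h.1, fun hi => ?_⟩
  obtain ⟨r, hr, hm⟩ := int_ray' D hi (0, s)
  have := h.2 _ (interior_subset hm) (by simp)
  simp only [Prod.snd_add, Prod.smul_snd, smul_eq_mul] at this
  nlinarith [hs.sq]

lemma ext_frontier (D : TriDisk ι) {p : ℝ × ℝ} (hp : p ∈ D.space) (h : ¬ D.NonExt p) :
    p ∈ frontier D.space := by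
  rw [frontier_eq]
  refine ⟨hp, fun hi => h ⟨?_, ?_⟩⟩
  · obtain ⟨r, hr, hm⟩ := int_ray' D hi (-1, 0)
    exact ⟨_, interior_subset hm, by simp [hr]⟩
  · obtain ⟨r, hr, hm⟩ := int_ray' D hi (1, 0)
    exact ⟨_, interior_subset hm, by simp [hr]⟩

lemma exists_top (D : TriDisk ι) (s : ℝ) {p : ℝ × ℝ} (hp : p ∈ D.space) :
    ∃ q, D.IsTop s q ∧ q.1 = p.1 := by
  have hc : IsCompact (D.space ∩ {q | q.1 = p.1}) :=
    (space_compact D).inter_right (isClosed_eq continuous_fst continuous_const)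
  obtain ⟨q, hq, hm⟩ := hc.exists_isMaxOn ⟨p, hp, rfl⟩
    (f := fun q => s * q.2) (by fun_prop)
  refine ⟨q, ⟨hq.1, fun r hr h => hm ⟨hr, ?_⟩⟩, hq.2⟩
  rw [Set.mem_ofPred_eq, h]; exact hq.2

lemma NonExt.congr {D : TriDisk ι} {p q : ℝ × ℝ} (h : D.NonExt p) (hq : q.1 = p.1) : D.NonExt q := by
  unfold NonExt at *; rw [hq]; exact h

/-- The convex body has an interior point on every nonextreme line. -/
lemma body_int {D : TriDisk ι} {v : ℝ × ℝ → ℝ × ℝ} (H : Hyp D v) {C : Set (ℝ × ℝ)} (hC : Convex ℝ C)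
    (hCc : IsCompact C) (hCi : (interior C).Nonempty) (hvC : v '' frontier D.space = frontier C)
    {p : ℝ × ℝ} (hp : D.NonExt p) : ∃ z ∈ interior C, z.1 = p.1 := by
  have key : ∀ q ∈ D.space, ∃ a ∈ C, a.1 = q.1 := by
    intro q hq
    obtain ⟨r, hr, hr1⟩ := exists_top D 1 hq
    have hf := top_frontier D (Or.inl rfl) hr
    refine ⟨v r, hCc.isClosed.frontier_subset (hvC ▸ Set.mem_image_of_mem v hf), ?_⟩
    rw [H.hvert r hf, hr1]
  obtain ⟨⟨q, hq, hqp⟩, ⟨r, hr, hrp⟩⟩ := hp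
  obtain ⟨a, ha, ha1⟩ := key q hq
  obtain ⟨b, hb, hb1⟩ := key r hr
  obtain ⟨z, hz⟩ := hCi
  have seg : ∀ w ∈ C, (z.1 < p.1 ∧ p.1 < w.1 ∨ w.1 < p.1 ∧ p.1 < z.1) →
      ∃ z ∈ interior C, z.1 = p.1 := by
    intro w hw h
    have hne : w.1 - z.1 ≠ 0 := by
      intro h0
      rcases h with h | h <;> linarith
    have h1 : 0 < (w.1 - p.1) / (w.1 - z.1) := by
      rcases h with h | h
      · apply div_pos <;> linarith
      · apply div_pos_of_neg_of_neg <;> linarith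
    have h2 : 0 < (p.1 - z.1) / (w.1 - z.1) := by
      rcases h with h | h
      · apply div_pos <;> linarith
      · apply div_pos_of_neg_of_neg <;> linarith
    refine ⟨((w.1 - p.1) / (w.1 - z.1)) • z + ((p.1 - z.1) / (w.1 - z.1)) • w,
      hC.openSegment_interior_self_subset_interior hz hw ⟨_, _, h1, h2, ?_, rfl⟩, ?_⟩
    · field_simp; ring
    · simp; field_simp; ring
  rcases lt_trichotomy z.1 p.1 with h | h | h
  · exact seg b hb (Or.inl ⟨h, by rw [hb1]; exact hrp⟩)
  · exact ⟨z, hz, h⟩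
  · exact seg a ha (Or.inr ⟨by rw [ha1]; exact hqp, h⟩)

/-- On a vertical line through the interior, a point of `C` strictly between two points of `C`
is interior. -/
lemma mid_int {C : Set (ℝ × ℝ)} (hC : Convex ℝ C) {z a b m : ℝ × ℝ} (hz : z ∈ interior C)
    (ha : a ∈ C) (hb : b ∈ C) (h1 : a.1 = z.1) (h2 : b.1 = z.1) (h3 : m.1 = z.1)
    (h4 : a.2 < m.2) (h5 : m.2 < b.2) : m ∈ interior C := by
  have seg : ∀ w ∈ C, w.1 = z.1 → (z.2 < m.2 ∧ m.2 < w.2 ∨ w.2 < m.2 ∧ m.2 < z.2) →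
      m ∈ interior C := by
    intro w hw hw1 h
    have hne : w.2 - z.2 ≠ 0 := by
      intro h0
      rcases h with h | h <;> linarith
    have h1 : 0 < (w.2 - m.2) / (w.2 - z.2) := by
      rcases h with h | h
      · apply div_pos <;> linarith
      · apply div_pos_of_neg_of_neg <;> linarith
    have h2 : 0 < (m.2 - z.2) / (w.2 - z.2) := by
      rcases h with h | h
      · apply div_pos <;> linarith
      · apply div_pos_of_neg_of_neg <;> linarith
    have he : m = ((w.2 - m.2) / (w.2 - z.2)) • z + ((m.2 - z.2) / (w.2 - z.2)) • w := by
      ext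
      · simp [hw1, h3]; field_simp; ring
      · simp; field_simp; ring
    rw [he]
    refine hC.openSegment_interior_self_subset_interior hz hw ⟨_, _, h1, h2, ?_, rfl⟩
    field_simp; ring
  rcases lt_trichotomy z.2 m.2 with h | h | h
  · exact seg b hb h2 (Or.inl ⟨h, h5⟩)
  · have : m = z := Prod.ext h3 h.symm
    rw [this]; exact hz
  · exact seg a ha h1 (Or.inr ⟨h4, h⟩)

lemma nonext_interior {D : TriDisk ι} {v : ℝ × ℝ → ℝ × ℝ} (H : Hyp D v) {p : ℝ × ℝ}
    (hp : p ∈ D.space) (hn : D.NonExt p) (h1 : ¬ D.IsTop 1 p) (h2 : ¬ D.IsTop (-1) p) :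
    p ∈ interior D.space := by
  obtain ⟨C, hC, hCc, hCi, hvC⟩ := H.hconv
  obtain ⟨z, hz, hz1⟩ := body_int H hC hCc hCi hvC hn
  by_contra hpi
  have hpf : p ∈ frontier D.space := by rw [frontier_eq]; exact ⟨hp, hpi⟩
  obtain ⟨q, hq, hq1⟩ := exists_top D 1 hp
  obtain ⟨r, hr, hr1⟩ := exists_top D (-1) hp
  have hqf := top_frontier D (Or.inl rfl) hq
  have hrf := top_frontier D (Or.inr rfl) hr
  have hqp : q ≠ p := fun h => h1 (h ▸ hq)
  have hrp : r ≠ p := fun h => h2 (h ▸ hr)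
  have hqr : q ≠ r := by
    rintro rfl
    apply hqp
    have a := hq.2 p hp hq1.symm
    have b := hr.2 p hp hq1.symm
    exact Prod.ext hq1 (by linarith)
  have hfr : ∀ x ∈ frontier D.space, v x ∈ C ∧ v x ∉ interior C := by
    intro x hx
    have : v x ∈ frontier C := hvC ▸ Set.mem_image_of_mem v hx
    rw [hCc.isClosed.frontier_eq] at this
    exact this
  have hne : ∀ x ∈ frontier D.space, ∀ y ∈ frontier D.space, x.1 = p.1 → y.1 = p.1 → x ≠ y →
      (v x).2 < (v y).2 ∨ (v y).2 < (v x).2 := by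
    intro x hx y hy hx1 hy1 hxy
    apply lt_or_gt_of_ne
    intro h
    apply hxy
    apply H.hinj hx hy
    exact Prod.ext (by rw [H.hvert x hx, H.hvert y hy, hx1, hy1]) h
  have mid : ∀ x ∈ frontier D.space, ∀ y ∈ frontier D.space, ∀ w ∈ frontier D.space,
      x.1 = p.1 → y.1 = p.1 → w.1 = p.1 → (v x).2 < (v y).2 → (v y).2 < (v w).2 → False := by
    intro x hx y hy w hw hx1 hy1 hw1 ha hb
    exact (hfr y hy).2 (mid_int hC hz (hfr x hx).1 (hfr w hw).1
      (by rw [H.hvert x hx, hx1, hz1]) (by rw [H.hvert w hw, hw1, hz1])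
      (by rw [H.hvert y hy, hy1, hz1]) ha hb)
  rcases hne p hpf q hqf rfl hq1 hqp.symm with a | a <;>
  rcases hne p hpf r hrf rfl hr1 hrp.symm with b | b <;>
  rcases hne q hqf r hrf hq1 hr1 hqr with c | c <;>
  first
  | exact mid p hpf q hqf r hrf rfl hq1 hr1 (by assumption) (by assumption)
  | exact mid p hpf r hrf q hqf rfl hr1 hq1 (by assumption) (by assumption)
  | exact mid q hqf p hpf r hrf hq1 rfl hr1 (by assumption) (by assumption)
  | exact mid q hqf r hrf p hpf hq1 hr1 rfl (by assumption) (by assumption)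
  | exact mid r hrf p hpf q hqf hr1 rfl hq1 (by assumption) (by assumption)
  | exact mid r hrf q hqf p hpf hr1 hq1 rfl (by assumption) (by assumption)

lemma top_ne {D : TriDisk ι} {v : ℝ × ℝ → ℝ × ℝ} (H : Hyp D v) {p : ℝ × ℝ}
    (hn : D.NonExt p) (h1 : D.IsTop 1 p) (h2 : D.IsTop (-1) p) : False := by
  obtain ⟨C, hC, hCc, hCi, hvC⟩ := H.hconv
  obtain ⟨z, hz, hz1⟩ := body_int H hC hCc hCi hvC hn
  have huniq : ∀ q ∈ D.space, q.1 = p.1 → q = p := by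
    intro q hq h
    have a := h1.2 q hq h
    have b := h2.2 q hq h
    exact Prod.ext h (by linarith)
  have key : ∀ s : ℝ, IsSign s → ∃ w ∈ frontier C, w.1 = p.1 ∧ s * z.2 < s * w.2 := by
    intro s hs
    have hc : IsCompact (C ∩ {q | q.1 = p.1}) :=
      hCc.inter_right (isClosed_eq continuous_fst continuous_const)
    obtain ⟨w, hw, hm⟩ := hc.exists_isMaxOn ⟨z, interior_subset hz, hz1⟩
      (f := fun q => s * q.2) (by fun_prop)
    have up : ∀ q ∈ interior C, ∃ r > (0:ℝ), (q.1, q.2 + r * s) ∈ C := by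
      intro q hq
      have h : Tendsto (fun r : ℝ => (q.1, q.2 + r * s)) (𝓝 0) (𝓝 q) := by
        have : Continuous (fun r : ℝ => (q.1, q.2 + r * s)) := by fun_prop
        simpa using this.tendsto 0
      have := ((h.eventually (isOpen_interior.mem_nhds hq)).filter_mono
        (nhdsWithin_le_nhds (s := Set.Ioi 0))).and self_mem_nhdsWithin
      obtain ⟨r, h, hr⟩ := this.exists
      exact ⟨r, hr, interior_subset h⟩
    refine ⟨w, ?_, hw.2, ?_⟩
    · rw [hCc.isClosed.frontier_eq]
      refine ⟨hw.1, fun hi => ?_⟩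
      obtain ⟨r, hr, h⟩ := up w hi
      have := hm ⟨h, hw.2⟩
      simp only [Set.mem_ofPred_eq] at this
      nlinarith [hs.sq]
    · obtain ⟨r, hr, h⟩ := up z hz
      have := hm ⟨h, hz1⟩
      simp only [Set.mem_ofPred_eq] at this
      nlinarith [hs.sq]
  have key2 : ∀ w ∈ frontier C, w.1 = p.1 → w = v p := by
    intro w hw hw1
    rw [← hvC] at hw
    obtain ⟨q, hq, rfl⟩ := hw
    rw [huniq q (fr_sub D hq) (by rw [← H.hvert q hq, hw1])]
  obtain ⟨a, ha, ha1, ha2⟩ := key 1 (Or.inl rfl)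
  obtain ⟨b, hb, hb1, hb2⟩ := key (-1) (Or.inr rfl)
  rw [key2 a ha ha1] at ha2
  rw [key2 b hb hb1] at hb2
  linarith

lemma frontier_cases {D : TriDisk ι} {v : ℝ × ℝ → ℝ × ℝ} (H : Hyp D v) {p : ℝ × ℝ}
    (hn : D.NonExt p) (hp : p ∈ frontier D.space) : D.IsTop 1 p ∨ D.IsTop (-1) p := by
  by_contra h
  push Not at h
  rw [frontier_eq] at hp
  exact hp.2 (nonext_interior H hp.1 hn h.1 h.2)

lemma top_ne' {D : TriDisk ι} {v : ℝ × ℝ → ℝ × ℝ} (H : Hyp D v) {p : ℝ × ℝ} {s : ℝ} (hs : IsSign s)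
    (hn : D.NonExt p) (h1 : D.IsTop s p) (h2 : D.IsTop (-s) p) : False := by
  rcases hs with rfl | rfl
  · exact top_ne H hn h1 h2
  · exact top_ne H hn (by simpa using h2) h1

lemma frontier_cases' {D : TriDisk ι} {v : ℝ × ℝ → ℝ × ℝ} (H : Hyp D v) {p : ℝ × ℝ} {s : ℝ}
    (hs : IsSign s) (hn : D.NonExt p) (hp : p ∈ frontier D.space) : D.IsTop s p ∨ D.IsTop (-s) p := by
  rcases hs with rfl | rfl
  · exact frontier_cases H hn hp
  · rw [neg_neg]; exact (frontier_cases H hn hp).symm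

lemma nonext_interior' {D : TriDisk ι} {v : ℝ × ℝ → ℝ × ℝ} (H : Hyp D v) {p : ℝ × ℝ} {s : ℝ}
    (hs : IsSign s) (hp : p ∈ D.space) (hn : D.NonExt p) (h1 : ¬ D.IsTop s p)
    (h2 : ¬ D.IsTop (-s) p) : p ∈ interior D.space := by
  by_contra h
  have : p ∈ frontier D.space := by rw [frontier_eq]; exact ⟨hp, h⟩
  rcases frontier_cases' H hs hn this with h | h <;> contradiction

/-- Strictly between two points of a nonextreme slice we are in the interior. -/
lemma between_interior {D : TriDisk ι} {v : ℝ × ℝ → ℝ × ℝ} (H : Hyp D v) {p q r : ℝ × ℝ}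
    (hp : p ∈ D.space) (hq : q ∈ D.space) (hn : D.NonExt r) (h1 : p.1 = r.1) (h2 : q.1 = r.1)
    (h3 : p.2 < r.2) (h4 : r.2 < q.2) : r ∈ interior D.space := by
  refine nonext_interior H (slice_mem D H.hT hp hq h1 h2 h3.le h4.le) hn ?_ ?_
  · intro h; have := h.2 q hq h2; linarith
  · intro h; have := h.2 p hp h1; linarith

lemma near_int {D : TriDisk ι} {v : ℝ × ℝ → ℝ × ℝ} (H : Hyp D v) {p : ℝ × ℝ} {s : ℝ} (hs : IsSign s)
    (hn : D.NonExt p) (h : D.IsTop s p) {e : ℝ} (he : 0 < e) :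
    ∃ η, 0 < η ∧ η < e ∧ (p.1, p.2 - s * η) ∈ interior D.space := by
  obtain ⟨q, hq, hq1⟩ := exists_top D (-s) h.1
  have hlt : 0 < s * p.2 - s * q.2 := by
    have := h.2 q hq.1 hq1
    rcases lt_or_eq_of_le this with h' | h'
    · linarith
    · exfalso
      have : q = p := Prod.ext hq1 (by rcases hs with rfl | rfl <;> linarith)
      subst this
      exact top_ne' H hs hn h hq
  set η := min (e / 2) ((s * p.2 - s * q.2) / 2)
  have h0 : 0 < η := lt_min (by linarith) (by linarith)
  have h1 : η ≤ e / 2 := min_le_left _ _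
  have h2 : η ≤ (s * p.2 - s * q.2) / 2 := min_le_right _ _
  refine ⟨η, h0, by linarith, ?_⟩
  have hn' : D.NonExt (p.1, p.2 - s * η) := hn.congr rfl
  rcases hs with rfl | rfl
  · exact between_interior H hq.1 h.1 hn' hq1 rfl (by simp; linarith) (by simp; linarith)
  · exact between_interior H h.1 hq.1 hn' rfl hq1 (by simp; linarith) (by simp; linarith)

lemma tri_x_ne (D : TriDisk ι) {t : ι × ι × ι} (ht : t ∈ D.tris) (c : ℝ) :
    ∃ w ∈ vset t, (D.pos w).1 ≠ c := by
  by_contra h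
  push Not at h
  have h1 := congrArg Prod.fst (bc_comb D ht (c + 1, 0))
  rw [Prod.fst_sum] at h1
  simp only [Prod.smul_fst, smul_eq_mul] at h1
  have : ∑ i, D.bc t i (c + 1, 0) * (D.pos i).1 = ∑ i, D.bc t i (c + 1, 0) * c := by
    apply Finset.sum_congr rfl
    intro i _
    by_cases hi : i ∈ vset t
    · rw [h i hi]
    · simp [bc_out D ht hi]
  rw [this, ← Finset.sum_mul, bc_sum D ht] at h1
  linarith

/-- The projection to the first coordinate is open on the space. -/
lemma fst_open {D : TriDisk ι} {v : ℝ × ℝ → ℝ × ℝ} (H : Hyp D v) {p : ℝ × ℝ} (hp : p ∈ D.space)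
    {e : ℝ} (he : 0 < e) : ∃ δ > 0, ∀ c, |c - p.1| < δ → (∃ q ∈ D.space, q.1 = c) →
      ∃ q ∈ D.space, q.1 = c ∧ |q.2 - p.2| < e := by
  by_cases hn : D.NonExt p
  · obtain ⟨q, hq, hq1, hq2⟩ : ∃ q ∈ interior D.space, q.1 = p.1 ∧ |q.2 - p.2| < e := by
      by_cases h1 : D.IsTop 1 p
      · obtain ⟨η, h0, h3, h4⟩ := near_int H (Or.inl rfl) hn h1 he
        exact ⟨_, h4, rfl, by simp [abs_of_pos h0, h3]⟩
      · by_cases h2 : D.IsTop (-1) p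
        · obtain ⟨η, h0, h3, h4⟩ := near_int H (Or.inr rfl) hn h2 he
          exact ⟨_, h4, rfl, by simp [abs_of_pos h0, h3]⟩
        · exact ⟨p, nonext_interior H hp hn h1 h2, rfl, by simpa using he⟩
    have := int_ray D hq (1, 0)
    rw [Metric.eventually_nhds_iff] at this
    obtain ⟨δ, hδ, h⟩ := this
    refine ⟨δ, hδ, fun c hc _ => ?_⟩
    have := h (y := c - p.1) (by simpa [Real.dist_eq] using hc)
    exact ⟨_, interior_subset this, by simp [hq1], by simpa using hq2⟩
  · obtain ⟨t, ht, hpt⟩ := (mem_space D).1 hp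
    obtain ⟨w, hw, hw1⟩ := tri_x_ne D ht p.1
    have hne : (D.pos w).1 - p.1 ≠ 0 := sub_ne_zero.2 hw1
    have hpos : 0 < |(D.pos w).1 - p.1| := abs_pos.2 hne
    have hM : 0 < |(D.pos w).2 - p.2| + 1 := by positivity
    refine ⟨min |(D.pos w).1 - p.1| (|(D.pos w).1 - p.1| * e / (|(D.pos w).2 - p.2| + 1)),
      lt_min hpos (by positivity), fun c hc hq => ?_⟩
    have hc1 := lt_of_lt_of_le hc (min_le_left _ _)
    have hc2 := lt_of_lt_of_le hc (min_le_right _ _)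
    set r := (c - p.1) / ((D.pos w).1 - p.1) with hr
    have hwS : D.pos w ∈ D.space := tri_sub D ht (vert_mem D hw)
    have hr0 : 0 ≤ r := by
      obtain ⟨q, hq, rfl⟩ := hq
      unfold NonExt at hn
      rw [not_and_or] at hn
      push Not at hn
      rcases hn with hn | hn
      · have a := hn q hq
        have b := hn _ hwS
        apply div_nonneg <;> linarith
      · have a := hn q hq
        have b := hn _ hwS
        apply div_nonneg_of_nonpos <;> linarith
    have hrabs : r = |c - p.1| / |(D.pos w).1 - p.1| := by
      rw [← abs_div, abs_of_nonneg hr0]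
    have hr1 : r < 1 := by
      rw [hrabs, div_lt_one hpos]; exact hc1
    refine ⟨(1 - r) • p + r • D.pos w, tri_sub D ht ?_, ?_, ?_⟩
    · exact (convex_convexHull ℝ _) hpt (vert_mem D hw) (by linarith) hr0 (by ring)
    · simp only [Prod.fst_add, Prod.smul_fst, smul_eq_mul]
      have : r * ((D.pos w).1 - p.1) = c - p.1 := by rw [hr]; field_simp
      linarith
    · simp only [Prod.snd_add, Prod.smul_snd, smul_eq_mul]
      have h3 : (1 - r) * p.2 + r * (D.pos w).2 - p.2 = r * ((D.pos w).2 - p.2) := by ring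
      rw [h3, abs_mul, abs_of_nonneg hr0]
      have h4 : r * (|(D.pos w).2 - p.2| + 1) < e := by
        rw [hrabs]
        rw [lt_div_iff₀ hM] at hc2
        rw [div_mul_eq_mul_div, div_lt_iff₀ hpos]
        linarith
      nlinarith

lemma top_closed {D : TriDisk ι} {v : ℝ × ℝ → ℝ × ℝ} (H : Hyp D v) {s : ℝ} (hs : IsSign s) :
    IsClosed {p | D.IsTop s p} := by
  apply isClosed_of_closure_subset
  intro p hp
  rw [mem_closure_iff_seq_limit] at hp
  obtain ⟨x, hx, hlim⟩ := hp
  have hpS : p ∈ D.space := (space_compact D).isClosed.mem_of_tendsto hlim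
    (Eventually.of_forall fun n => (hx n).1)
  refine ⟨hpS, fun q hq hq1 => ?_⟩
  by_contra hlt
  push Not at hlt
  obtain ⟨δ, hδ, h⟩ := fst_open H hq (e := (s * q.2 - s * p.2) / 2) (by linarith)
  have h1 : Tendsto (fun n => (x n).1) atTop (𝓝 p.1) := (continuous_fst.tendsto p).comp hlim
  have h2 : Tendsto (fun n => (x n).2) atTop (𝓝 p.2) := (continuous_snd.tendsto p).comp hlim
  rw [Metric.tendsto_atTop] at h1 h2
  obtain ⟨N, hN⟩ := h1 δ hδ
  obtain ⟨M, hM⟩ := h2 ((s * q.2 - s * p.2) / 2) (by linarith)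
  have a := hN (max N M) (le_max_left _ _)
  have b := hM (max N M) (le_max_right _ _)
  rw [Real.dist_eq] at a b
  obtain ⟨r, hr, hr1, hr2⟩ := h (x (max N M)).1 (by rw [hq1]; exact a) ⟨_, (hx _).1, rfl⟩
  have c := (hx (max N M)).2 r hr hr1
  rw [abs_lt] at b hr2
  rcases hs with rfl | rfl <;> linarith

lemma v_cont {D : TriDisk ι} {v : ℝ × ℝ → ℝ × ℝ} (H : Hyp D v) :
    ContinuousOn v (frontier D.space) := by
  let f : (ι × ι) ⊕ ι → Set (ℝ × ℝ) := fun x => match x with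
    | Sum.inl e => {p | D.IsBoundaryEdge e.1 e.2 ∧ p ∈ segment ℝ (D.pos e.1) (D.pos e.2)}
    | Sum.inr i => {D.pos i}
  have hsub : frontier D.space ⊆ ⋃ x, f x := by
    intro p hp
    obtain ⟨t, ht, hpt⟩ := (mem_space D).1 (fr_sub D hp)
    rcases tri_cases D ht hpt with ⟨i, hi, rfl⟩ | ⟨a, ha, b, hb, hab, hs⟩ | h
    · exact Set.mem_iUnion.2 ⟨Sum.inr i, rfl⟩
    · exact Set.mem_iUnion.2 ⟨Sum.inl (a, b), edge_boundary D ht ha hb hab hs hp,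
        openSegment_subset_segment ℝ _ _ hs⟩
    · rw [frontier_eq] at hp
      exact absurd (interior_mono (tri_sub D ht) h) hp.2
  refine ContinuousOn.mono ?_ hsub
  apply (locallyFinite_of_finite f).continuousOn_iUnion
  · rintro (e | i)
    · by_cases h : D.IsBoundaryEdge e.1 e.2
      · simp only [f, h, true_and, Set.ofPred_mem_eq]
        rw [← convexHull_pair]
        exact ((Set.toFinite _).isCompact_convexHull (𝕜 := ℝ)).isClosed
      · simp [f, h]
    · exact isClosed_singleton
  · rintro (e | i)
    · by_cases h : D.IsBoundaryEdge e.1 e.2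
      · simp only [f, h, true_and, Set.ofPred_mem_eq]
        obtain ⟨g, hg⟩ := H.hSL _ _ h
        exact (AffineMap.continuous_of_finiteDimensional g).continuousOn.congr hg
      · simp [f, h]
    · exact continuousOn_singleton _ _

end TriDisk

namespace TriDisk

set_option linter.unusedSectionVars false
variable {ι : Type} [Fintype ι] [DecidableEq ι]
open Filter Topology

lemma body_top {C : Set (ℝ × ℝ)} (hCc : IsCompact C) {z : ℝ × ℝ} (hz : z ∈ interior C)
    {s : ℝ} (hs : IsSign s) : ∃ w ∈ frontier C, w.1 = z.1 ∧ s * z.2 < s * w.2 := by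
  have hc : IsCompact (C ∩ {q | q.1 = z.1}) :=
    hCc.inter_right (isClosed_eq continuous_fst continuous_const)
  obtain ⟨w, hw, hm⟩ := hc.exists_isMaxOn ⟨z, interior_subset hz, rfl⟩
    (f := fun q => s * q.2) (by fun_prop)
  have up : ∀ q ∈ interior C, ∃ r > (0:ℝ), (q.1, q.2 + r * s) ∈ C := by
    intro q hq
    have h : Tendsto (fun r : ℝ => (q.1, q.2 + r * s)) (𝓝 0) (𝓝 q) := by
      have : Continuous (fun r : ℝ => (q.1, q.2 + r * s)) := by fun_prop
      simpa using this.tendsto 0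
    have := ((h.eventually (isOpen_interior.mem_nhds hq)).filter_mono
      (nhdsWithin_le_nhds (s := Set.Ioi 0))).and self_mem_nhdsWithin
    obtain ⟨r, h, hr⟩ := this.exists
    exact ⟨r, hr, interior_subset h⟩
  refine ⟨w, ?_, hw.2, ?_⟩
  · rw [hCc.isClosed.frontier_eq]
    refine ⟨hw.1, fun hi => ?_⟩
    obtain ⟨r, hr, h⟩ := up w hi
    have := hm ⟨h, hw.2⟩
    simp only [Set.mem_ofPred_eq] at this
    nlinarith [hs.sq]
  · obtain ⟨r, hr, h⟩ := up z hz
    have := hm ⟨h, rfl⟩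
    simp only [Set.mem_ofPred_eq] at this
    nlinarith [hs.sq]

lemma nonext_exists {D : TriDisk ι} {v : ℝ × ℝ → ℝ × ℝ} (H : Hyp D v) {p : ℝ × ℝ}
    (hn : D.NonExt p) : ∃ q ∈ D.space, q.1 = p.1 := by
  obtain ⟨C, hC, hCc, hCi, hvC⟩ := H.hconv
  obtain ⟨z, hz, hz1⟩ := body_int H hC hCc hCi hvC hn
  obtain ⟨w, hw, hw1, -⟩ := body_top hCc hz (s := 1) (Or.inl rfl)
  rw [← hvC] at hw
  obtain ⟨q, hq, rfl⟩ := hw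
  exact ⟨q, fr_sub D hq, by rw [← H.hvert q hq, hw1, hz1]⟩

lemma top_unique {D : TriDisk ι} {s : ℝ} (hs : IsSign s) {p q : ℝ × ℝ} (hp : D.IsTop s p)
    (hq : D.IsTop s q) (h : p.1 = q.1) : p = q := by
  have a := hp.2 q hq.1 h.symm
  have b := hq.2 p hp.1 h
  exact Prod.ext h (by rcases hs with rfl | rfl <;> linarith)

lemma orient_closed {D : TriDisk ι} {v : ℝ × ℝ → ℝ × ℝ} (H : Hyp D v) (s : ℝ) :
    IsClosed {c : ℝ | ∃ p q, D.IsTop 1 p ∧ D.IsTop (-1) q ∧ p.1 = c ∧ q.1 = c ∧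
      0 ≤ s * ((v p).2 - (v q).2)} := by
  let T : Set ((ℝ × ℝ) × (ℝ × ℝ)) :=
    ({p | D.IsTop 1 p} ×ˢ {p | D.IsTop (-1) p}) ∩ {x | x.1.1 = x.2.1}
  have hTc : IsCompact T := by
    apply IsCompact.inter_right _ (isClosed_eq (by fun_prop) (by fun_prop))
    apply IsCompact.prod
    · exact (space_compact D).of_isClosed_subset (top_closed H (Or.inl rfl)) fun p hp => hp.1
    · exact (space_compact D).of_isClosed_subset (top_closed H (Or.inr rfl)) fun p hp => hp.1
  have hv := v_cont H
  have hf : ContinuousOn (fun x : (ℝ × ℝ) × (ℝ × ℝ) => s * ((v x.1).2 - (v x.2).2)) T := by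
    have h1 : ContinuousOn (fun x : (ℝ × ℝ) × (ℝ × ℝ) => v x.1) T :=
      hv.comp continuousOn_fst fun x hx => top_frontier D (Or.inl rfl) hx.1.1
    have h2 : ContinuousOn (fun x : (ℝ × ℝ) × (ℝ × ℝ) => v x.2) T :=
      hv.comp continuousOn_snd fun x hx => top_frontier D (Or.inr rfl) hx.1.2
    exact continuousOn_const.mul (h1.snd.sub h2.snd)
  have hcl : IsClosed (T ∩ (fun x : (ℝ × ℝ) × (ℝ × ℝ) => s * ((v x.1).2 - (v x.2).2)) ⁻¹' Set.Ici 0) :=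
    hf.preimage_isClosed_of_isClosed hTc.isClosed isClosed_Ici
  have hcc := hTc.of_isClosed_subset hcl Set.inter_subset_left
  have := (hcc.image (f := fun x => x.1.1) (by fun_prop)).isClosed
  convert this using 1
  ext c
  constructor
  · rintro ⟨p, q, hp, hq, hp1, hq1, h⟩
    exact ⟨(p, q), ⟨⟨⟨hp, hq⟩, hp1.trans hq1.symm⟩, h⟩, hp1⟩
  · rintro ⟨⟨p, q⟩, ⟨⟨⟨hp, hq⟩, h1⟩, h⟩, hc⟩
    exact ⟨p, q, hp, hq, hc, h1.symm.trans hc, h⟩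

lemma orient {D : TriDisk ι} {v : ℝ × ℝ → ℝ × ℝ} (H : Hyp D v) :
    ∃ s, IsSign s ∧ ∀ p q, D.IsTop 1 p → D.IsTop (-1) q → p.1 = q.1 →
      0 ≤ s * ((v p).2 - (v q).2) := by
  let J : Set ℝ := {c | D.NonExt (c, 0)}
  let A : ℝ → Set ℝ := fun s => {c : ℝ | ∃ p q, D.IsTop 1 p ∧ D.IsTop (-1) q ∧ p.1 = c ∧ q.1 = c ∧
      0 ≤ s * ((v p).2 - (v q).2)}
  have hAcl : ∀ s, IsClosed (A s) := orient_closed H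
  have hcov : J ⊆ A 1 ∪ A (-1) := by
    intro c hc
    obtain ⟨r, hr, hr1⟩ := nonext_exists H hc
    obtain ⟨p, hp, hp1⟩ := exists_top D 1 hr
    obtain ⟨q, hq, hq1⟩ := exists_top D (-1) hr
    rcases le_total 0 ((v p).2 - (v q).2) with h | h
    · left; exact ⟨p, q, hp, hq, hp1.trans hr1, hq1.trans hr1, by linarith⟩
    · right; exact ⟨p, q, hp, hq, hp1.trans hr1, hq1.trans hr1, by linarith⟩
  have hJ : IsPreconnected J := by
    apply Set.OrdConnected.isPreconnected
    constructor
    rintro a ⟨⟨x, hx, hxa⟩, -⟩ b ⟨-, ⟨y, hy, hyb⟩⟩ c ⟨h1, h2⟩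
    exact ⟨⟨x, hx, lt_of_lt_of_le hxa h1⟩, ⟨y, hy, lt_of_le_of_lt h2 hyb⟩⟩
  have huniq : ∀ s c, c ∈ A s → ∀ p q, D.IsTop 1 p → D.IsTop (-1) q → p.1 = c → q.1 = c →
      0 ≤ s * ((v p).2 - (v q).2) := by
    rintro s c ⟨p', q', hp', hq', hp1', hq1', h⟩ p q hp hq hp1 hq1
    rw [top_unique (Or.inl rfl) hp hp' (hp1.trans hp1'.symm),
      top_unique (Or.inr rfl) hq hq' (hq1.trans hq1'.symm)]
    exact h
  obtain ⟨s, hs, hsub⟩ : ∃ s, IsSign s ∧ J ⊆ A s := by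
    by_contra hcon
    push Not at hcon
    have h1 := hcon 1 (Or.inl rfl)
    have h2 := hcon (-1) (Or.inr rfl)
    rw [Set.not_subset] at h1 h2
    obtain ⟨x, hx, hx'⟩ := h1
    obtain ⟨y, hy, hy'⟩ := h2
    obtain ⟨c, hc, hc1, hc2⟩ := isPreconnected_closed_iff.1 hJ _ _ (hAcl 1) (hAcl (-1)) hcov
      ⟨y, hy, (hcov hy).resolve_right hy'⟩ ⟨x, hx, (hcov hx).resolve_left hx'⟩
    obtain ⟨p, q, hp, hq, hp1, hq1, h⟩ := hc1
    have h' := huniq _ _ hc2 p q hp hq hp1 hq1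
    have hpf := top_frontier D (Or.inl rfl) hp
    have hqf := top_frontier D (Or.inr rfl) hq
    have : p = q := H.hinj hpf hqf (Prod.ext
      (by rw [H.hvert p hpf, H.hvert q hqf, hp1, hq1]) (by linarith))
    subst this
    exact top_ne H (NonExt.congr hc hp1) hp hq
  refine ⟨s, hs, fun p q hp hq hpq => huniq s p.1 ?_ p q hp hq rfl hpq.symm⟩
  have hcl := (hAcl s).closure_subset_iff.2 hsub
  by_cases hn : D.NonExt p
  · exact hsub (hn.congr rfl)
  · apply hcl
    obtain ⟨t, ht, hpt⟩ := (mem_space D).1 hp.1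
    obtain ⟨w, hw, hw1⟩ := tri_x_ne D ht p.1
    have hwS : D.pos w ∈ D.space := tri_sub D ht (vert_mem D hw)
    rcases lt_or_gt_of_ne hw1 with h | h
    · have : Set.Ioo (D.pos w).1 p.1 ⊆ J := fun c hc =>
        ⟨⟨_, hwS, hc.1⟩, ⟨p, hp.1, hc.2⟩⟩
      apply closure_mono this
      rw [closure_Ioo h.ne]
      exact ⟨h.le, le_rfl⟩
    · have : Set.Ioo p.1 (D.pos w).1 ⊆ J := fun c hc =>
        ⟨⟨p, hp.1, hc.1⟩, ⟨_, hwS, hc.2⟩⟩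
      apply closure_mono this
      rw [closure_Ioo h.ne]
      exact ⟨le_rfl, h.le⟩

/-- Orientation: `v` preserves the vertical order on the frontier. -/
def VMono (D : TriDisk ι) (v : ℝ × ℝ → ℝ × ℝ) : Prop :=
  ∀ p ∈ frontier D.space, ∀ q ∈ frontier D.space, p.1 = q.1 → p.2 < q.2 → (v p).2 < (v q).2

lemma vmono_of {D : TriDisk ι} {v : ℝ × ℝ → ℝ × ℝ} (H : Hyp D v)
    (ho : ∀ p q, D.IsTop 1 p → D.IsTop (-1) q → p.1 = q.1 → (v q).2 ≤ (v p).2) : D.VMono v := by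
  intro p hp q hq hpq hlt
  have hinj : ∀ p ∈ frontier D.space, ∀ q ∈ frontier D.space, p.1 = q.1 → (v p).2 = (v q).2 → p = q := by
    intro p hp q hq h1 h2
    exact H.hinj hp hq (Prod.ext (by rw [H.hvert p hp, H.hvert q hq, h1]) h2)
  by_cases hn : D.NonExt p
  · have hpb : D.IsTop (-1) p := by
      rcases frontier_cases H hn hp with h | h
      · have := h.2 q (fr_sub D hq) hpq.symm; linarith
      · exact h
    have hqt : D.IsTop 1 q := by
      rcases frontier_cases H (hn.congr hpq.symm) hq with h | h
      · exact h
      · have := h.2 p (fr_sub D hp) hpq; linarith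
    refine lt_of_le_of_ne (ho q p hqt hpb hpq.symm) fun h => ?_
    rw [hinj p hp q hq hpq h] at hlt
    exact lt_irrefl _ hlt
  · obtain ⟨P, hP, hP1⟩ := exists_top D 1 (fr_sub D hp)
    obtain ⟨Q, hQ, hQ1⟩ := exists_top D (-1) (fr_sub D hp)
    have hQp := hQ.2 p (fr_sub D hp) hQ1.symm
    have hPq := hP.2 q (fr_sub D hq) (hpq.symm.trans hP1.symm)
    have hmem : ∀ y ∈ Set.Icc Q.2 P.2, (p.1, y) ∈ frontier D.space := by
      intro y hy
      exact ext_frontier D (slice_mem D H.hT hQ.1 hP.1 hQ1 hP1 hy.1 hy.2) fun h => hn (h.congr rfl)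
    have hc : ContinuousOn (fun y => (v (p.1, y)).2) (Set.Icc Q.2 P.2) := by
      apply continuous_snd.comp_continuousOn
      exact (v_cont H).comp (by fun_prop) hmem
    have hi : Set.InjOn (fun y => (v (p.1, y)).2) (Set.Icc Q.2 P.2) := by
      intro y hy z hz h
      exact congrArg Prod.snd (hinj _ (hmem y hy) _ (hmem z hz) rfl h)
    have eP : (p.1, P.2) = P := Prod.ext hP1.symm rfl
    have eQ : (p.1, Q.2) = Q := Prod.ext hQ1.symm rfl
    have hsm := hc.strictMonoOn_of_injOn_Icc (by linarith)
      (by show (v (p.1, Q.2)).2 ≤ (v (p.1, P.2)).2; rw [eP, eQ]; exact ho P Q hP hQ (hP1.trans hQ1.symm)) hi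
    have := @hsm p.2 ⟨by linarith, by linarith⟩ q.2 ⟨by linarith, by linarith⟩ hlt
    have eq : (p.1, q.2) = q := Prod.ext hpq rfl
    simpa [eq] using this

lemma vmono_sign {D : TriDisk ι} {v : ℝ × ℝ → ℝ × ℝ} (hm : D.VMono v) {s : ℝ} (hs : IsSign s)
    {p q : ℝ × ℝ} (hp : p ∈ frontier D.space) (hq : q ∈ frontier D.space) (h1 : p.1 = q.1)
    (h : s * p.2 < s * q.2) : s * (v p).2 < s * (v q).2 := by
  rcases hs with rfl | rfl
  · have := hm p hp q hq h1 (by linarith); linarith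
  · have := hm q hq p hp h1.symm (by linarith); linarith

/-- Support line of the convex polygon at a top point. -/
lemma support {D : TriDisk ι} {v : ℝ × ℝ → ℝ × ℝ} (H : Hyp D v) (hm : D.VMono v) {s : ℝ}
    (hs : IsSign s) {p : ℝ × ℝ} (hn : D.NonExt p) (hp : D.IsTop s p) :
    ∃ m : ℝ, ∀ q ∈ frontier D.space, s * ((v q).2 - (v p).2 - m * (q.1 - p.1)) ≤ 0 := by
  have hpf := top_frontier D hs hp
  obtain ⟨C, hC, hCc, hCi, hvC⟩ := H.hconv
  obtain ⟨z, hz, hz1⟩ := body_int H hC hCc hCi hvC hn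
  have hfr : ∀ x ∈ frontier D.space, v x ∈ C ∧ v x ∉ interior C := by
    intro x hx
    have : v x ∈ frontier C := hvC ▸ Set.mem_image_of_mem v hx
    rw [hCc.isClosed.frontier_eq] at this
    exact this
  obtain ⟨f, hf⟩ := geometric_hahn_banach_open_point hC.interior isOpen_interior (hfr p hpf).2
  have hle : ∀ a ∈ C, f a ≤ f (v p) := by
    intro a ha
    have h1 : a ∈ closure (interior C) := by
      rw [hC.closure_interior_eq_closure_of_nonempty_interior hCi]; exact subset_closure ha
    exact (isClosed_le f.continuous continuous_const).closure_subset_iff.2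
      (fun x hx => (hf x hx).le) h1
  have hdec : ∀ x : ℝ × ℝ, f x = x.1 * f (1, 0) + x.2 * f (0, 1) := by
    intro x
    have : x = x.1 • ((1 : ℝ), (0 : ℝ)) + x.2 • ((0 : ℝ), (1 : ℝ)) := by ext <;> simp
    conv_lhs => rw [this]
    simp only [map_add, map_smul, smul_eq_mul]
  set f1 := f (1, 0)
  set f2 := f (0, 1)
  have h1 := hf z hz
  rw [hdec, hdec (v p), H.hvert p hpf, hz1] at h1
  obtain ⟨q, hq, hq1⟩ := exists_top D (-s) hp.1
  have hqf := top_frontier D hs.neg hq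
  have h2 := hle _ (hfr q hqf).1
  rw [hdec, hdec (v p), H.hvert p hpf, H.hvert q hqf, hq1] at h2
  have hlt : s * q.2 < s * p.2 := by
    refine lt_of_le_of_ne (hp.2 q hq.1 hq1) fun h => ?_
    have : q = p := Prod.ext hq1 (by rcases hs with rfl | rfl <;> linarith)
    subst this
    exact top_ne' H hs hn hp hq
  have h3 := vmono_sign hm hs hqf hpf hq1 hlt
  have hf2 : f2 ≠ 0 := by
    intro h; rw [h] at h1; linarith
  have hsf : 0 < s * f2 := by
    rcases hs with rfl | rfl
    · have : 0 ≤ f2 := by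
        by_contra hc; push Not at hc; nlinarith
      rw [one_mul]; exact lt_of_le_of_ne this hf2.symm
    · have : f2 ≤ 0 := by
        by_contra hc; push Not at hc; nlinarith
      have := lt_of_le_of_ne this hf2
      linarith
  refine ⟨-f1 / f2, fun r hr => ?_⟩
  have h4 := hle _ (hfr r hr).1
  rw [hdec, hdec (v p), H.hvert p hpf, H.hvert r hr] at h4
  have h5 : s * ((v r).2 - (v p).2 - -f1 / f2 * (r.1 - p.1)) * (s * f2) =
      (s * s) * (((v r).2 - (v p).2) * f2 + f1 * (r.1 - p.1)) := by
    field_simp; ring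
  rw [hs.sq] at h5
  by_contra hc
  push Not at hc
  have := mul_pos hc hsf
  rw [h5] at this
  nlinarith

end TriDisk

namespace TriDisk

set_option linter.unusedSectionVars false
variable {ι : Type} [Fintype ι] [DecidableEq ι]
open Filter Topology

/-- The vertex `i` belongs to some triangle. -/
def Used (D : TriDisk ι) (i : ι) : Prop := ∃ t ∈ D.tris, i ∈ vset t

lemma Used.mem {D : TriDisk ι} {i : ι} (h : D.Used i) : D.pos i ∈ D.space := by
  obtain ⟨t, ht, hi⟩ := h
  exact tri_sub D ht (vert_mem D hi)

lemma IsEdge.used {D : TriDisk ι} {i j : ι} (h : D.IsEdge i j) : D.Used j := by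
  obtain ⟨_, t, ht, _, hj⟩ := h
  exact ⟨t, ht, hj⟩

lemma exists_weights {D : TriDisk ι} {v : ℝ × ℝ → ℝ × ℝ} (H : Hyp D v) {i : ι} (hi : D.Used i)
    (hn : D.NonExt (D.pos i)) : ∃ l : ι → ℝ, (∀ j, D.IsEdge i j → 0 < l j) ∧
      (∀ j, ¬ D.IsEdge i j → l j = 0) ∧
      ∑ j, l j * ((D.pos j).1 - (D.pos i).1) = 0 ∧
      (D.pos i ∈ interior D.space → ∑ j, l j * ((D.pos j).2 - (D.pos i).2) = 0) ∧
      (∀ s, IsSign s → D.IsTop s (D.pos i) → s * ∑ j, l j * ((D.pos j).2 - (D.pos i).2) < 0) := by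
  classical
  obtain ⟨t0, ht0, hit0⟩ := hi
  have hnear := near_vert D ht0 hit0
  rw [eventually_nhdsWithin_iff, Metric.eventually_nhds_iff] at hnear
  obtain ⟨e, he, hnear⟩ := hnear
  obtain ⟨q, hq, hqd, hq1, hq2, hq3⟩ : ∃ q ∈ interior D.space, dist q (D.pos i) < e ∧
      q.1 = (D.pos i).1 ∧ (D.pos i ∈ interior D.space → q.2 = (D.pos i).2) ∧
      (∀ s, IsSign s → D.IsTop s (D.pos i) → s * (q.2 - (D.pos i).2) < 0) := by
    by_cases hinner : D.pos i ∈ interior D.space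
    · refine ⟨_, hinner, by simpa using he, rfl, fun _ => rfl, fun s hs ht => ?_⟩
      have := top_frontier D hs ht
      rw [frontier_eq] at this
      exact absurd hinner this.2
    · have hfr : D.pos i ∈ frontier D.space := by
        rw [frontier_eq]; exact ⟨Used.mem ⟨t0, ht0, hit0⟩, hinner⟩
      obtain ⟨s, hs, htop⟩ : ∃ s, IsSign s ∧ D.IsTop s (D.pos i) := by
        rcases frontier_cases H hn hfr with h | h
        · exact ⟨1, Or.inl rfl, h⟩
        · exact ⟨-1, Or.inr rfl, h⟩
      obtain ⟨η, h0, h1, h2⟩ := near_int H hs hn htop he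
      refine ⟨_, h2, ?_, rfl, fun h => absurd h hinner, fun s' hs' ht' => ?_⟩
      · rw [Prod.dist_eq]
        simp only [dist_self, Real.dist_eq]
        have : |(D.pos i).2 - s * η - (D.pos i).2| = η := by
          rcases hs with rfl | rfl <;> simp [abs_of_pos h0]
        rw [this]; exact max_lt he h1
      · have : s' = s := by
          by_contra hne
          have : s' = -s := by
            rcases hs with rfl | rfl <;> rcases hs' with rfl | rfl <;> norm_num at *
          rw [this] at ht'
          exact top_ne' H hs hn htop ht'
        subst this
        have := hs.sq
        simp only
        nlinarith
  set W : ℝ × ℝ := ∑ j, (if D.IsEdge i j then (1:ℝ) else 0) • (D.pos j - D.pos i) with hW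
  obtain ⟨ε, hε, hεS, hεd⟩ : ∃ ε > (0:ℝ), q + ε • (-W) ∈ D.space ∧ dist (q + ε • (-W)) (D.pos i) < e := by
    have h1 := int_ray D hq (-W)
    have h2 : ∀ᶠ r in 𝓝 (0 : ℝ), dist (q + r • (-W)) (D.pos i) < e := by
      have : Continuous (fun r : ℝ => dist (q + r • (-W)) (D.pos i)) := by fun_prop
      apply this.tendsto 0 |>.eventually (gt_mem_nhds _)
      simpa using hqd
    have := ((h1.and h2).filter_mono (nhdsWithin_le_nhds (s := Set.Ioi 0))).and self_mem_nhdsWithin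
    obtain ⟨r, ⟨h, h'⟩, hr⟩ := this.exists
    exact ⟨r, hr, interior_subset h, h'⟩
  have hhat := hnear hεd hεS
  obtain ⟨t, ht, hmt⟩ := (mem_space D).1 hεS
  have hit : i ∈ vset t := hat_pos_mem D ht hmt hhat.ne'
  set μ : ι → ℝ := fun j => D.bc t j (q + ε • (-W)) with hμ
  have hμ0 : ∀ j, 0 ≤ μ j := (bc_mem D ht _).1 hmt
  have hμz : ∀ j, ¬ D.IsEdge i j → μ j = 0 ∨ j = i := by
    intro j hj
    by_cases hji : j = i
    · exact Or.inr hji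
    · left
      have : j ∉ vset t := fun h => hj ⟨Ne.symm hji, t, ht, hit, h⟩
      simp [hμ, bc_out D ht this]
  have hsum : ∑ j, μ j • (D.pos j - D.pos i) = q + ε • (-W) - D.pos i := by
    simp only [smul_sub, Finset.sum_sub_distrib, ← Finset.sum_smul]
    rw [hμ, bc_comb D ht, bc_sum D ht, one_smul]
  have hmain : ∑ j, (if D.IsEdge i j then ε + μ j else 0) • (D.pos j - D.pos i) = q - D.pos i := by
    have : ∑ j, (if D.IsEdge i j then ε + μ j else 0) • (D.pos j - D.pos i)
        = ε • W + ∑ j, μ j • (D.pos j - D.pos i) := by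
      rw [hW, Finset.smul_sum, ← Finset.sum_add_distrib]
      apply Finset.sum_congr rfl
      intro j _
      by_cases hj : D.IsEdge i j
      · simp [hj, add_smul]
      · rcases hμz j hj with h | h
        · simp [hj, h]
        · simp [h]
    rw [this, hsum, smul_neg]; abel
  have m1 := congrArg Prod.fst hmain
  have m2 := congrArg Prod.snd hmain
  rw [Prod.fst_sum] at m1
  rw [Prod.snd_sum] at m2
  simp only [Prod.smul_fst, Prod.fst_sub, smul_eq_mul] at m1
  simp only [Prod.smul_snd, Prod.snd_sub, smul_eq_mul] at m2
  refine ⟨fun j => if D.IsEdge i j then ε + μ j else 0, ?_, ?_, ?_, ?_, ?_⟩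
  · intro j hj
    simp only [hj, if_true]
    linarith [hμ0 j]
  · intro j hj; simp [hj]
  · rw [m1, hq1]; ring
  · intro h; rw [m2, hq2 h]; ring
  · intro s hs h; rw [m2]; exact hq3 s hs h

/-- Admissible weights. -/
structure Wts (D : TriDisk ι) (l : ι → ι → ℝ) : Prop where
  pos : ∀ i, D.Used i → D.NonExt (D.pos i) → ∀ j, D.IsEdge i j → 0 < l i j
  zero : ∀ i, D.Used i → D.NonExt (D.pos i) → ∀ j, ¬ D.IsEdge i j → l i j = 0
  xbal : ∀ i, D.Used i → D.NonExt (D.pos i) → ∑ j, l i j * ((D.pos j).1 - (D.pos i).1) = 0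
  ybal : ∀ i, D.Used i → D.NonExt (D.pos i) → D.pos i ∈ interior D.space →
    ∑ j, l i j * ((D.pos j).2 - (D.pos i).2) = 0
  ytop : ∀ i, D.Used i → D.NonExt (D.pos i) → ∀ s, IsSign s → D.IsTop s (D.pos i) →
    s * ∑ j, l i j * ((D.pos j).2 - (D.pos i).2) < 0

lemma exists_wts {D : TriDisk ι} {v : ℝ × ℝ → ℝ × ℝ} (H : Hyp D v) : ∃ l, D.Wts l := by
  have : ∀ i, ∃ l : ι → ℝ, D.Used i → D.NonExt (D.pos i) → (∀ j, D.IsEdge i j → 0 < l j) ∧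
      (∀ j, ¬ D.IsEdge i j → l j = 0) ∧
      ∑ j, l j * ((D.pos j).1 - (D.pos i).1) = 0 ∧
      (D.pos i ∈ interior D.space → ∑ j, l j * ((D.pos j).2 - (D.pos i).2) = 0) ∧
      (∀ s, IsSign s → D.IsTop s (D.pos i) → s * ∑ j, l j * ((D.pos j).2 - (D.pos i).2) < 0) := by
    intro i
    by_cases h : D.Used i ∧ D.NonExt (D.pos i)
    · obtain ⟨l, hl⟩ := exists_weights H h.1 h.2
      exact ⟨l, fun _ _ => hl⟩
    · exact ⟨0, fun h1 h2 => absurd ⟨h1, h2⟩ h⟩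
  choose l hl using this
  exact ⟨l, fun i h1 h2 => (hl i h1 h2).1, fun i h1 h2 => (hl i h1 h2).2.1,
    fun i h1 h2 => (hl i h1 h2).2.2.1, fun i h1 h2 => (hl i h1 h2).2.2.2.1,
    fun i h1 h2 => (hl i h1 h2).2.2.2.2⟩

/-- Weighted Laplacian. -/
def lap (l : ι → ι → ℝ) (u : ι → ℝ) (i : ι) : ℝ := ∑ j, l i j * (u j - u i)

lemma lap_lin (l : ι → ι → ℝ) (u w : ι → ℝ) (a b : ℝ) (i : ι) :
    lap l (fun j => a * u j + b * w j) i = a * lap l u i + b * lap l w i := by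
  simp only [lap, Finset.mul_sum, ← Finset.sum_add_distrib]
  exact Finset.sum_congr rfl fun j _ => by ring

lemma nonext_of_int (D : TriDisk ι) {p : ℝ × ℝ} (h : p ∈ interior D.space) : D.NonExt p := by
  by_contra hn
  have := ext_frontier D (interior_subset h) hn
  rw [frontier_eq] at this
  exact this.2 h

/-- If all neighbours satisfy `u j ≤ u i` and the Laplacian is nonnegative, then equality. -/
lemma nbr_eq {D : TriDisk ι} {l : ι → ι → ℝ} (W : D.Wts l) {u : ι → ℝ} {i : ι} (hi : D.Used i)
    (hn : D.NonExt (D.pos i)) (h1 : ∀ j, D.IsEdge i j → u j ≤ u i) (h2 : 0 ≤ lap l u i) :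
    ∀ j, D.IsEdge i j → u j = u i := by
  have hterm : ∀ j ∈ Finset.univ, l i j * (u j - u i) ≤ 0 := by
    intro j _
    by_cases hj : D.IsEdge i j
    · have := W.pos i hi hn j hj
      have := h1 j hj
      exact mul_nonpos_of_nonneg_of_nonpos (by linarith) (by linarith)
    · rw [W.zero i hi hn j hj]; simp
  have h0 : ∑ j, l i j * (u j - u i) = 0 := le_antisymm (Finset.sum_nonpos hterm) h2
  rw [Finset.sum_eq_zero_iff_of_nonpos hterm] at h0
  intro j hj
  have := h0 j (Finset.mem_univ _)
  rcases mul_eq_zero.1 this with h | h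
  · exact absurd h (W.pos i hi hn j hj).ne'
  · linarith

lemma exists_right {D : TriDisk ι} {l : ι → ι → ℝ} (W : D.Wts l) {i : ι} (hi : D.Used i)
    (hn : D.NonExt (D.pos i)) : ∃ j, D.IsEdge i j ∧ (D.pos i).1 < (D.pos j).1 := by
  by_contra hc
  push Not at hc
  have h := nbr_eq W (u := fun j => (D.pos j).1) hi hn hc (W.xbal i hi hn).ge
  obtain ⟨t, ht, hit⟩ := hi
  obtain ⟨w, hw, hw1⟩ := tri_x_ne D ht (D.pos i).1
  refine hw1 (h w ⟨?_, t, ht, hit, hw⟩)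
  rintro rfl; exact hw1 rfl

lemma max_principle {D : TriDisk ι} {l : ι → ι → ℝ} (W : D.Wts l) {u : ι → ℝ} {M : ℝ}
    (h1 : ∀ i, D.Used i → D.pos i ∈ interior D.space → 0 ≤ lap l u i)
    (h2 : ∀ i, D.Used i → D.pos i ∈ frontier D.space → u i ≤ M) :
    ∀ i, D.Used i → u i ≤ M := by
  classical
  intro k hk
  by_contra hlt
  push Not at hlt
  obtain ⟨i0, hi0, hmax⟩ := Finset.exists_max_image (Finset.univ.filter fun i => D.Used i) u
    ⟨k, by simp [hk]⟩
  obtain ⟨i, hi, hmax2⟩ := Finset.exists_max_image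
    (Finset.univ.filter fun i => D.Used i ∧ u i = u i0) (fun i => (D.pos i).1)
    ⟨i0, by simp at hi0; simp [hi0]⟩
  simp only [Finset.mem_filter, Finset.mem_univ, true_and] at hi hi0 hmax hmax2
  have hiM : M < u i := by rw [hi.2]; exact lt_of_lt_of_le hlt (hmax k hk)
  have hinner : D.pos i ∈ interior D.space := by
    by_contra h
    have := h2 i hi.1 (by rw [frontier_eq]; exact ⟨hi.1.mem, h⟩)
    linarith
  have hn := nonext_of_int D hinner
  have heq := nbr_eq W hi.1 hn (u := u) (fun j hj => by rw [hi.2]; exact hmax j hj.used)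
    (h1 i hi.1 hinner)
  obtain ⟨j, hj, hj1⟩ := exists_right W hi.1 hn
  have := hmax2 j ⟨hj.used, (heq j hj).trans hi.2⟩
  linarith

lemma exists_harm {D : TriDisk ι} {l : ι → ι → ℝ} (W : D.Wts l) (g : ι → ℝ) :
    ∃ h : ι → ℝ, (∀ i, D.Used i → D.pos i ∈ interior D.space → lap l h i = 0) ∧
      (∀ i, D.Used i → D.pos i ∈ frontier D.space → h i = g i) := by
  classical
  let L : (ι → ℝ) →ₗ[ℝ] (ι → ℝ) :=
    { toFun := fun h i => if D.Used i ∧ D.pos i ∈ interior D.space then lap l h i else h i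
      map_add' := by
        intro x y
        ext i
        have := lap_lin l x y 1 1 i
        simp only [one_mul] at this
        by_cases hi : D.Used i ∧ D.pos i ∈ interior D.space
        · simp only [hi, and_self, if_true, Pi.add_apply]; exact this
        · simp [hi]
      map_smul' := by
        intro c x
        ext i
        have := lap_lin l x x c 0 i
        simp only [zero_mul, add_zero] at this
        by_cases hi : D.Used i ∧ D.pos i ∈ interior D.space
        · simp only [hi, and_self, if_true, Pi.smul_apply, RingHom.id_apply, smul_eq_mul]; exact this
        · simp [hi] }
  have hLap : ∀ h i, L h i = if D.Used i ∧ D.pos i ∈ interior D.space then lap l h i else h i :=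
    fun h i => rfl
  have hfr : ∀ i, D.pos i ∈ frontier D.space → ¬ (D.Used i ∧ D.pos i ∈ interior D.space) := by
    intro i hi h
    rw [frontier_eq] at hi
    exact hi.2 h.2
  have hinj : Function.Injective L := by
    rw [← LinearMap.ker_eq_bot, LinearMap.ker_eq_bot']
    intro h hh
    have key : ∀ i, (if D.Used i ∧ D.pos i ∈ interior D.space then lap l h i else h i) = 0 :=
      fun i => by rw [← hLap, hh]; rfl
    have k1 : ∀ i, D.Used i → D.pos i ∈ interior D.space → lap l h i = 0 := fun i a b => by
      have := key i; rwa [if_pos ⟨a, b⟩] at this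
    have k2 : ∀ i, D.Used i → D.pos i ∈ frontier D.space → h i = 0 := fun i a b => by
      have := key i; rwa [if_neg (hfr i b)] at this
    have hle := max_principle W (u := h) (M := 0) (fun i a b => (k1 i a b).ge) fun i a b => (k2 i a b).le
    have hge := max_principle W (u := fun j => (-1) * h j + 0 * h j) (M := 0)
      (fun i a b => by rw [lap_lin, k1 i a b]; simp) fun i a b => by simp [k2 i a b]
    ext i
    by_cases hi : D.Used i
    · have a := hle i hi
      have b := hge i hi
      simp only [Pi.zero_apply]
      linarith
    · have := key i; rw [if_neg (fun h => hi h.1)] at this; exact this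
  obtain ⟨h, hh⟩ := (LinearMap.injective_iff_surjective.1 hinj)
    (fun i => if D.Used i ∧ D.pos i ∈ interior D.space then 0 else g i)
  refine ⟨h, fun i a b => ?_, fun i a b => ?_⟩
  · have := congrFun hh i
    rwa [hLap, if_pos ⟨a, b⟩, if_pos ⟨a, b⟩] at this
  · have := congrFun hh i
    rwa [hLap, if_neg (hfr i b), if_neg (hfr i b)] at this

lemma ext_frontier_eq {D : TriDisk ι} {v : ℝ × ℝ → ℝ × ℝ} (H : Hyp D v) {h : ι → ℝ}
    (hh : ∀ i, D.Used i → D.pos i ∈ frontier D.space → h i = (v (D.pos i)).2) {p : ℝ × ℝ}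
    (hp : p ∈ frontier D.space) : D.ext h p = (v p).2 := by
  obtain ⟨t, ht, hpt⟩ := (mem_space D).1 (fr_sub D hp)
  rcases tri_cases D ht hpt with ⟨i, hi, rfl⟩ | ⟨a, ha, b, hb, hab, hs⟩ | hi
  · rw [ext_vert D ht hi, hh i ⟨t, ht, hi⟩ hp]
  · have hE := edge_boundary D ht ha hb hab hs hp
    obtain ⟨g, hg⟩ := H.hSL _ _ hE
    have hpa := hE.2 (left_mem_segment ℝ _ _)
    have hpb := hE.2 (right_mem_segment ℝ _ _)
    have ga := hg (left_mem_segment ℝ _ _)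
    have gb := hg (right_mem_segment ℝ _ _)
    have gp := hg (openSegment_subset_segment ℝ _ _ hs)
    rw [ext_eq D ht hpt, gp]
    obtain ⟨r, s, hr, hs, hrs, rfl⟩ := hs
    rw [aff_combo _ hrs, ← ext_eq D ht (vert_mem D ha), ← ext_eq D ht (vert_mem D hb),
      ext_vert D ht ha, ext_vert D ht hb, hh a ⟨t, ht, ha⟩ hpa, hh b ⟨t, ht, hb⟩ hpb, ga, gb]
    have := aff_combo ((LinearMap.snd ℝ ℝ ℝ).toAffineMap.comp g) hrs (D.pos a) (D.pos b)
    simpa using this.symm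
  · rw [frontier_eq] at hp
    exact absurd (interior_mono (tri_sub D ht) hi) hp.2

lemma lap_x {D : TriDisk ι} {l : ι → ι → ℝ} (W : D.Wts l) {i : ι} (hi : D.Used i)
    (hn : D.NonExt (D.pos i)) : lap l (fun j => (D.pos j).1) i = 0 := W.xbal i hi hn

lemma load {D : TriDisk ι} {v : ℝ × ℝ → ℝ × ℝ} (H : Hyp D v) (hm : D.VMono v) {l : ι → ι → ℝ}
    (W : D.Wts l) {h : ι → ℝ}
    (h0 : ∀ i, D.Used i → D.pos i ∈ interior D.space → lap l h i = 0)
    (hh : ∀ i, D.Used i → D.pos i ∈ frontier D.space → h i = (v (D.pos i)).2)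
    {i : ι} (hi : D.Used i) (hn : D.NonExt (D.pos i)) {s : ℝ} (hs : IsSign s)
    (hnt : ¬ D.IsTop (-s) (D.pos i)) : s * lap l h i ≤ 0 := by
  by_cases hinner : D.pos i ∈ interior D.space
  · rw [h0 i hi hinner]; simp
  have hfr : D.pos i ∈ frontier D.space := by rw [frontier_eq]; exact ⟨hi.mem, hinner⟩
  have htop := (frontier_cases' H hs hn hfr).resolve_right hnt
  obtain ⟨m, hsup⟩ := support H hm hs hn htop
  set ψ : ι → ℝ := fun j => s * h j + (-(s * m)) * (D.pos j).1 with hψ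
  have hlap : ∀ k, D.Used k → D.NonExt (D.pos k) → lap l ψ k = s * lap l h k := by
    intro k hk hkn
    rw [hψ, lap_lin, lap_x W hk hkn]; ring
  have hle := max_principle W (u := ψ) (M := ψ i) (fun k hk hki => by
    rw [hlap k hk (nonext_of_int D hki), h0 k hk hki]; simp) (fun k hk hkf => by
    have := hsup _ hkf
    simp only [hψ]
    rw [hh k hk hkf, hh i hi hfr]
    nlinarith)
  rw [← hlap i hi hn]
  apply Finset.sum_nonpos
  intro j _
  by_cases hj : D.IsEdge i j
  · have := W.pos i hi hn j hj
    have := hle j hj.used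
    exact mul_nonpos_of_nonneg_of_nonpos (by linarith) (by linarith)
  · rw [W.zero i hi hn j hj]; simp

end TriDisk

namespace TriDisk

set_option linter.unusedSectionVars false
variable {ι : Type} [Fintype ι] [DecidableEq ι]
open Filter Topology

/-- The degenerate limit function, normalised. -/
structure Pert (D : TriDisk ι) (l : ι → ι → ℝ) (φ : ι → ℝ) : Prop where
  slope : ∀ t ∈ D.tris, 0 ≤ D.slope t φ
  load : ∀ i, D.Used i → D.NonExt (D.pos i) → ∀ s, IsSign s → ¬ D.IsTop (-s) (D.pos i) →
    s * lap l φ i ≤ 0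
  strict : ∀ p ∈ D.space, ∀ q ∈ D.space, p.1 = q.1 → ¬ D.NonExt p → p.2 < q.2 →
    D.ext φ p < D.ext φ q

lemma Pert.mono {D : TriDisk ι} {l : ι → ι → ℝ} {φ : ι → ℝ} (P : Pert D l φ) (hT : D.TrV) {s : ℝ}
    (hs : IsSign s) {p q : ℝ × ℝ} (hp : p ∈ D.space) (hq : q ∈ D.space) (h1 : p.1 = q.1)
    (h2 : s * p.2 ≤ s * q.2) : s * D.ext φ p ≤ s * D.ext φ q := by
  rcases hs with rfl | rfl
  · have := mono_slice D hT φ 0 P.slope hp hq h1 (by linarith)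
    linarith
  · have := mono_slice D hT φ 0 P.slope hq hp h1.symm (by linarith)
    linarith

lemma Pert.sstrict {D : TriDisk ι} {l : ι → ι → ℝ} {φ : ι → ℝ} (P : Pert D l φ) {s : ℝ}
    (hs : IsSign s) {p q : ℝ × ℝ} (hp : p ∈ D.space) (hq : q ∈ D.space) (h1 : p.1 = q.1)
    (hn : ¬ D.NonExt p) (h2 : s * p.2 < s * q.2) : s * D.ext φ p < s * D.ext φ q := by
  rcases hs with rfl | rfl
  · have := P.strict p hp q hq h1 hn (by linarith)
    linarith
  · have := P.strict q hq p hp h1.symm (fun h => hn (h.congr h1)) (by linarith)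
    linarith

/-- Endpoint condition. -/
def EndB (D : TriDisk ι) (φ : ι → ℝ) (s : ℝ) (i : ι) : Prop :=
  D.NonExt (D.pos i) → ¬ D.IsTop (-s) (D.pos i) →
    ¬ ∀ᶠ p in 𝓝[D.space] (D.pos i), 0 ≤ s * D.ext φ p

lemma endB_of {D : TriDisk ι} {l : ι → ι → ℝ} (W : D.Wts l) {φ : ι → ℝ} (P : Pert D l φ) {s : ℝ}
    (hs : IsSign s) {i : ι} (hi : D.Used i) (h0 : φ i = 0)
    (hQ : (∃ k, D.IsEdge i k ∧ φ k ≠ 0) ∨ (D.NonExt (D.pos i) → ¬ D.IsTop (-s) (D.pos i) →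
      s * lap l φ i < 0)) : D.EndB φ s i := by
  intro hn hnt hev
  have key : ∀ j, D.IsEdge i j → 0 ≤ s * φ j := by
    rintro j ⟨hij, t, ht, hit, hjt⟩
    by_contra hc
    push Not at hc
    have hlim : Tendsto (fun r : ℝ => D.pos i + r • (D.pos j - D.pos i)) (𝓝[>] 0) (𝓝[D.space] (D.pos i)) := by
      apply tendsto_nhdsWithin_of_tendsto_nhds_of_eventually_within
      · have : Continuous (fun r : ℝ => D.pos i + r • (D.pos j - D.pos i)) := by fun_prop
        have := this.tendsto 0
        simp only [zero_smul, add_zero] at this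
        exact this.mono_left nhdsWithin_le_nhds
      · filter_upwards [Ioo_mem_nhdsGT (zero_lt_one (α := ℝ))] with r hr
        apply tri_sub D ht
        apply seg_tri D hit hjt
        exact ⟨1 - r, r, by linarith [hr.2], hr.1.le, by ring, by rw [smul_sub, sub_smul, one_smul]; abel⟩
    have h2 := (hlim.eventually hev).and (Ioo_mem_nhdsGT (zero_lt_one (α := ℝ)))
    obtain ⟨r, hr1, hr2⟩ := h2.exists
    have hmem : D.pos i + r • (D.pos j - D.pos i) ∈ triSet D.pos t := by
      apply seg_tri D hit hjt
      exact ⟨1 - r, r, by linarith [hr2.2], hr2.1.le, by ring, by rw [smul_sub, sub_smul, one_smul]; abel⟩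
    rw [show D.pos i + r • (D.pos j - D.pos i) = (1 - r) • D.pos i + r • D.pos j by
      rw [smul_sub, sub_smul, one_smul]; abel] at hr1 hmem
    rw [ext_eq D ht hmem, aff_combo _ (by ring), ← ext_eq D ht (vert_mem D hit),
      ← ext_eq D ht (vert_mem D hjt), ext_vert D ht hit, ext_vert D ht hjt, h0] at hr1
    have := mul_pos hr2.1 (neg_pos.2 hc)
    nlinarith
  have hsum : 0 ≤ s * lap l φ i := by
    rw [lap, Finset.mul_sum]
    apply Finset.sum_nonneg
    intro j _
    by_cases hj : D.IsEdge i j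
    · have := W.pos i hi hn j hj
      have := mul_nonneg this.le (key j hj)
      rw [h0]; linarith
    · rw [W.zero i hi hn j hj]; simp
  rcases hQ with ⟨k, hk, hk0⟩ | hQ
  · have hload := P.load i hi hn s hs hnt
    have hnb := nbr_eq W (u := fun j => (-s) * φ j + 0 * φ j) hi hn (fun j hj => by
      have := key j hj; rw [h0]; linarith) (by rw [lap_lin]; linarith) k hk
    simp only [h0] at hnb
    apply hk0
    rcases hs with rfl | rfl <;> linarith
  · have := hQ hn hnt
    linarith

/-- A zero edge crossing the line `x = c`. -/
structure ZEdge (D : TriDisk ι) (φ : ι → ℝ) (δ c : ℝ) (a b : ι) : Prop where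
  tri : ∃ t ∈ D.tris, a ∈ vset t ∧ b ∈ vset t
  za : φ a = 0
  zb : φ b = 0
  xa : δ * (D.pos a).1 < δ * c
  xb : δ * c < δ * (D.pos b).1

lemma ZEdge.symm {D : TriDisk ι} {φ : ι → ℝ} {δ c : ℝ} {a b : ι} (h : ZEdge D φ δ c a b) :
    ZEdge D φ (-δ) c b a where
  tri := by obtain ⟨t, ht, ha, hb⟩ := h.tri; exact ⟨t, ht, hb, ha⟩
  za := h.zb
  zb := h.za
  xa := by linarith [h.xb]
  xb := by linarith [h.xa]

lemma ZEdge.ne {D : TriDisk ι} {φ : ι → ℝ} {δ c : ℝ} {a b : ι} (h : ZEdge D φ δ c a b) : a ≠ b := by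
  rintro rfl; linarith [h.xa, h.xb]

lemma ZEdge.zero {D : TriDisk ι} {φ : ι → ℝ} {δ c : ℝ} {a b : ι} (h : ZEdge D φ δ c a b) {p : ℝ × ℝ}
    (hp : p ∈ segment ℝ (D.pos a) (D.pos b)) : p ∈ D.space ∧ D.ext φ p = 0 := by
  obtain ⟨t, ht, ha, hb⟩ := h.tri
  have hm := seg_tri D ha hb hp
  refine ⟨tri_sub D ht hm, ?_⟩
  obtain ⟨r, s, hr, hs, hrs, rfl⟩ := hp
  rw [ext_eq D ht hm, aff_combo _ hrs, ← ext_eq D ht (vert_mem D ha),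
      ← ext_eq D ht (vert_mem D hb), ext_vert D ht ha, ext_vert D ht hb, h.za, h.zb]
  ring

lemma seg_line {P Q : ℝ × ℝ} {δ : ℝ} (hδ : IsSign δ) (h : δ * P.1 < δ * Q.1) :
    ∃ m k : ℝ, (∀ p ∈ segment ℝ P Q, p.2 = m * p.1 + k) ∧
      (∀ x, δ * P.1 ≤ δ * x → δ * x ≤ δ * Q.1 → (x, m * x + k) ∈ segment ℝ P Q) ∧
      (∀ x, δ * P.1 < δ * x → δ * x < δ * Q.1 → (x, m * x + k) ∈ openSegment ℝ P Q) := by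
  have hne : Q.1 - P.1 ≠ 0 := by
    intro h0
    have : Q.1 = P.1 := by linarith
    rw [this] at h; exact lt_irrefl _ h
  have e1 : ∀ x : ℝ, (Q.1 - x) / (Q.1 - P.1) = (δ * Q.1 - δ * x) / (δ * Q.1 - δ * P.1) := by
    intro x
    rcases hδ with rfl | rfl
    · simp
    · rw [← neg_div_neg_eq]; congr 1 <;> ring
  have e2 : ∀ x : ℝ, (x - P.1) / (Q.1 - P.1) = (δ * x - δ * P.1) / (δ * Q.1 - δ * P.1) := by
    intro x
    rcases hδ with rfl | rfl
    · simp
    · rw [← neg_div_neg_eq]; congr 1 <;> ring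
  have hd : 0 < δ * Q.1 - δ * P.1 := by linarith
  have hpt : ∀ x : ℝ, ((Q.1 - x) / (Q.1 - P.1)) • P + ((x - P.1) / (Q.1 - P.1)) • Q =
      (x, (Q.2 - P.2) / (Q.1 - P.1) * x + (P.2 - (Q.2 - P.2) / (Q.1 - P.1) * P.1)) := by
    intro x
    ext
    · simp; field_simp; ring
    · simp; field_simp; ring
  refine ⟨(Q.2 - P.2) / (Q.1 - P.1), P.2 - (Q.2 - P.2) / (Q.1 - P.1) * P.1, ?_, ?_, ?_⟩
  · rintro p ⟨r, s, hr, hs, hrs, rfl⟩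
    have : r = 1 - s := by linarith
    subst this
    simp; field_simp; ring
  · intro x h1 h2
    refine ⟨_, _, ?_, ?_, ?_, hpt x⟩
    · rw [e1]; apply div_nonneg <;> linarith
    · rw [e2]; apply div_nonneg <;> linarith
    · field_simp; ring
  · intro x h1 h2
    refine ⟨_, _, ?_, ?_, ?_, hpt x⟩
    · rw [e1]; apply div_pos <;> linarith
    · rw [e2]; apply div_pos <;> linarith
    · field_simp; ring

lemma crossing (D : TriDisk ι) {t t' : ι × ι × ι} (ht : t ∈ D.tris) (ht' : t' ∈ D.tris) {a b c d : ι}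
    (ha : a ∈ vset t) (hb : b ∈ vset t) (hab : a ≠ b) (hc : c ∈ vset t') (hd : d ∈ vset t')
    {p : ℝ × ℝ} (hp : p ∈ openSegment ℝ (D.pos a) (D.pos b))
    (hp' : p ∈ segment ℝ (D.pos c) (D.pos d)) : (a = c ∨ a = d) ∧ (b = c ∨ b = d) := by
  obtain ⟨h1, h2, -⟩ := hat_seg D ht ha hb hab hp
  have hm := seg_tri D hc hd hp'
  have key : ∀ i, 0 < D.hat i p → i = c ∨ i = d := by
    intro i hi
    by_contra hcon
    push Not at hcon
    rw [hat_eq D ht' hm] at hi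
    obtain ⟨r, s, hr, hs, hrs, rfl⟩ := hp'
    rw [bc_seg D ht' hc hd hrs] at hi
    simp [hcon.1, hcon.2] at hi
  exact ⟨key a h1, key b h2⟩

/-- Two zero edges, one strictly above the other at `c`, do not cross. -/
lemma no_cross {D : TriDisk ι} {φ ψ : ι → ℝ} {δ c0 : ℝ} (hδ : IsSign δ) {a b c d : ι}
    (E : ZEdge D φ δ c0 a b) (F : ZEdge D ψ δ c0 c d) {m k m' k' : ℝ}
    (h1 : ∀ x, δ * (D.pos a).1 < δ * x → δ * x < δ * (D.pos b).1 →
      (x, m * x + k) ∈ openSegment ℝ (D.pos a) (D.pos b))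
    (h2 : ∀ x, δ * (D.pos c).1 ≤ δ * x → δ * x ≤ δ * (D.pos d).1 →
      (x, m' * x + k') ∈ segment ℝ (D.pos c) (D.pos d))
    (hne : m * c0 + k ≠ m' * c0 + k')
    (l1 : ∀ p ∈ segment ℝ (D.pos a) (D.pos b), p.2 = m * p.1 + k)
    (l2 : ∀ p ∈ segment ℝ (D.pos c) (D.pos d), p.2 = m' * p.1 + k')
    {x : ℝ} (hx0 : δ * c0 ≤ δ * x) (hx1 : δ * x < δ * (D.pos b).1) (hx2 : δ * x ≤ δ * (D.pos d).1)
    (he : m * x + k = m' * x + k') : False := by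
  obtain ⟨t, ht, ha, hb⟩ := E.tri
  obtain ⟨t', ht', hc, hd⟩ := F.tri
  have p1 := h1 x (by linarith [E.xa]) hx1
  have p2 := h2 x (by linarith [F.xa]) hx2
  rw [← he] at p2
  obtain ⟨q1, q2⟩ := crossing D ht ht' ha hb E.ne hc hd p1 p2
  have hac : a = c := by
    rcases q1 with h | h
    · exact h
    · exfalso; have := E.xa; have := F.xb; rw [h] at *; linarith
  have hbd : b = d := by
    rcases q2 with h | h
    · exfalso; have := E.xb; have := F.xa; rw [h] at *; linarith
    · exact h
  subst hac; subst hbd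
  have r1 := l1 _ (left_mem_segment ℝ _ _)
  have r2 := l1 _ (right_mem_segment ℝ _ _)
  have r3 := l2 _ (left_mem_segment ℝ _ _)
  have r4 := l2 _ (right_mem_segment ℝ _ _)
  have hxx : (D.pos a).1 - (D.pos b).1 ≠ 0 := by
    intro h
    have : (D.pos a).1 = (D.pos b).1 := by linarith
    have h5 := E.xa; have h6 := E.xb
    rw [this] at h5; linarith
  have hmm : m = m' := by
    have : (m - m') * ((D.pos a).1 - (D.pos b).1) = 0 := by linarith
    rcases mul_eq_zero.1 this with h | h
    · linarith
    · exact absurd h hxx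
  apply hne
  subst hmm
  linarith

/-- Sign propagation for affine functions without zeros. -/
lemma aff_sign {δ A B c x : ℝ} (hδ : IsSign δ) (h0 : 0 < A * c + B) (hx : δ * c ≤ δ * x)
    (h : ∀ y, δ * c ≤ δ * y → δ * y ≤ δ * x → A * y + B ≠ 0) : 0 < A * x + B := by
  by_contra hc
  push Not at hc
  have hAx : A * c + B - (A * x + B) > 0 := by linarith
  set r := (A * c + B) / (A * c + B - (A * x + B)) with hr
  have hr0 : 0 ≤ r := div_nonneg h0.le hAx.le
  have hr1 : r ≤ 1 := by rw [hr, div_le_one hAx]; linarith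
  have hrr : r * (A * c + B - (A * x + B)) = A * c + B := by rw [hr]; field_simp
  refine h (c + r * (x - c)) ?_ ?_ ?_
  · have : 0 ≤ r * (δ * x - δ * c) := mul_nonneg hr0 (by linarith)
    linarith
  · have : r * (δ * x - δ * c) ≤ 1 * (δ * x - δ * c) :=
      mul_le_mul_of_nonneg_right hr1 (by linarith)
    linarith
  · linarith

end TriDisk

namespace TriDisk

set_option linter.unusedSectionVars false
set_option linter.unusedVariables false
variable {ι : Type} [Fintype ι] [DecidableEq ι]
open Filter Topology

lemma nonext_of_between {D : TriDisk ι} {δ : ℝ} (hδ : IsSign δ) {p q r : ℝ × ℝ} (hp : p ∈ D.space)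
    (hq : q ∈ D.space) (h1 : δ * p.1 < δ * r.1) (h2 : δ * r.1 < δ * q.1) : D.NonExt r := by
  rcases hδ with rfl | rfl
  · exact ⟨⟨p, hp, by linarith⟩, ⟨q, hq, by linarith⟩⟩
  · exact ⟨⟨q, hq, by linarith⟩, ⟨p, hp, by linarith⟩⟩

lemma end1 {D : TriDisk ι} (hT : D.TrV) {l : ι → ι → ℝ} {φ : ι → ℝ} (P : Pert D l φ) {s δ c0 : ℝ}
    (hs : IsSign s) (hδ : IsSign δ) {a b c d : ι} (E : ZEdge D φ δ c0 a b) (F : ZEdge D φ δ c0 c d)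
    {p q : ℝ × ℝ} (hp : p ∈ segment ℝ (D.pos a) (D.pos b)) (hq : q ∈ segment ℝ (D.pos c) (D.pos d))
    (hp1 : p.1 = c0) (hq1 : q.1 = c0) (hpq : s * q.2 < s * p.2) (hB : D.EndB φ (-s) d)
    (hx : δ * (D.pos d).1 < δ * (D.pos b).1) : False := by
  obtain ⟨m, k, l1, g1, o1⟩ := seg_line hδ (E.xa.trans E.xb)
  obtain ⟨m', k', l2, g2, o2⟩ := seg_line hδ (F.xa.trans F.xb)
  have hp2 := l1 p hp
  have hq2 := l2 q hq
  rw [hp1] at hp2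
  rw [hq1] at hq2
  have hd := l2 _ (right_mem_segment ℝ _ _)
  have hpos := aff_sign (A := s * (m - m')) (B := s * (k - k')) (c := c0) (x := (D.pos d).1) hδ
    (by rw [hp2, hq2] at hpq; linarith) F.xb.le (by
      intro y hy1 hy2 h0
      refine no_cross hδ E F o1 g2 ?_ l1 l2 hy1 (by linarith) hy2 ?_
      · intro h; rw [hp2, hq2, h] at hpq; exact lt_irrefl _ hpq
      · rcases hs with rfl | rfl <;> linarith)
  have habove : s * (D.pos d).2 < s * (m * (D.pos d).1 + k) := by rw [hd]; linarith
  have hbS := (E.zero (right_mem_segment ℝ _ _)).1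
  have hpS := (E.zero hp).1
  have hw := g1 (D.pos d).1 (by linarith [E.xa, F.xb]) hx.le
  refine hB (nonext_of_between hδ hpS hbS (by rw [hp1]; exact F.xb) hx) ?_ ?_
  · rw [neg_neg]
    intro ht
    have := ht.2 _ (E.zero hw).1 rfl
    simp only at this
    linarith
  · have e1 : ∀ᶠ r : ℝ × ℝ in 𝓝 (D.pos d), δ * c0 < δ * r.1 :=
      (isOpen_lt (by fun_prop) (by fun_prop)).mem_nhds F.xb
    have e2 : ∀ᶠ r : ℝ × ℝ in 𝓝 (D.pos d), δ * r.1 < δ * (D.pos b).1 :=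
      (isOpen_lt (by fun_prop) (by fun_prop)).mem_nhds hx
    have e3 : ∀ᶠ r : ℝ × ℝ in 𝓝 (D.pos d), s * r.2 < s * (m * r.1 + k) :=
      (isOpen_lt (by fun_prop) (by fun_prop)).mem_nhds habove
    filter_upwards [nhdsWithin_le_nhds e1, nhdsWithin_le_nhds e2, nhdsWithin_le_nhds e3,
      self_mem_nhdsWithin] with r h1 h2 h3 h4
    obtain ⟨hz, hz0⟩ := E.zero (g1 r.1 (by linarith [E.xa]) h2.le)
    have := P.mono hT hs h4 hz rfl h3.le
    rw [hz0] at this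
    linarith

lemma end2_side {D : TriDisk ι} (hT : D.TrV) {l : ι → ι → ℝ} {φ : ι → ℝ} (P : Pert D l φ)
    {s δ c0 : ℝ} (hs : IsSign s) (hδ : IsSign δ) {b c d : ι} (hbS : D.pos b ∈ D.space)
    (F : ZEdge D φ δ c0 c d)
    (hn : D.NonExt (D.pos b)) (hbd : (D.pos b).1 = (D.pos d).1) (hlt : s * (D.pos d).2 < s * (D.pos b).2)
    {q : ℝ × ℝ} (hq1 : q.1 = (D.pos b).1) (hq2 : s * q.2 < s * (D.pos b).2)
    {r0 : ℝ} (hr0 : 0 < r0) (hray : ∀ r : ℝ, 0 ≤ r → r ≤ r0 → q + r • (δ, (0:ℝ)) ∈ D.space ∧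
      0 ≤ s * D.ext φ (q + r • (δ, (0:ℝ)))) (hB : D.EndB φ s b) : False := by
  obtain ⟨m', k', l2, g2, o2⟩ := seg_line hδ (F.xa.trans F.xb)
  have hd := l2 _ (right_mem_segment ℝ _ _)
  refine hB hn ?_ ?_
  · intro ht
    have := ht.2 _ (F.zero (right_mem_segment ℝ _ _)).1 hbd.symm
    linarith
  · have e1 : ∀ᶠ r : ℝ × ℝ in 𝓝 (D.pos b), δ * c0 < δ * r.1 :=
      (isOpen_lt (by fun_prop) (by fun_prop)).mem_nhds (by rw [Set.mem_ofPred_eq, hbd]; exact F.xb)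
    have e2 : ∀ᶠ r : ℝ × ℝ in 𝓝 (D.pos b), δ * r.1 < δ * (D.pos b).1 + r0 :=
      (isOpen_lt (by fun_prop) (by fun_prop)).mem_nhds (by rw [Set.mem_ofPred_eq]; linarith)
    have e3 : ∀ᶠ r : ℝ × ℝ in 𝓝 (D.pos b), s * (m' * r.1 + k') < s * r.2 :=
      (isOpen_lt (by fun_prop) (by fun_prop)).mem_nhds
        (by rw [Set.mem_ofPred_eq, hbd, ← hd]; exact hlt)
    have e4 : ∀ᶠ r : ℝ × ℝ in 𝓝 (D.pos b), s * q.2 < s * r.2 :=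
      (isOpen_lt (by fun_prop) (by fun_prop)).mem_nhds hq2
    filter_upwards [nhdsWithin_le_nhds e1, nhdsWithin_le_nhds e2, nhdsWithin_le_nhds e3,
      nhdsWithin_le_nhds e4, self_mem_nhdsWithin] with r h1 h2 h3 h4 h5
    rcases le_or_gt (δ * r.1) (δ * (D.pos b).1) with h | h
    · obtain ⟨hz, hz0⟩ := F.zero (g2 r.1 (by linarith [F.xa]) (by rw [← hbd]; exact h))
      have := P.mono hT hs hz h5 rfl h3.le
      rw [hz0] at this
      linarith
    · obtain ⟨hz, hz0⟩ := hray (δ * r.1 - δ * (D.pos b).1) (by linarith) (by linarith)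
      have := P.mono hT hs hz h5 (by
        simp only [Prod.fst_add, Prod.smul_fst, smul_eq_mul, hq1]
        have := hδ.sq
        linear_combination (r.1 - (D.pos b).1) * this) (by simpa using h4.le)
      linarith

lemma end_eq {D : TriDisk ι} {v : ℝ × ℝ → ℝ × ℝ} (H : Hyp D v) {l : ι → ι → ℝ} {φ : ι → ℝ}
    (P : Pert D l φ) {δ c0 : ℝ} (hδ : IsSign δ) {a b c d : ι} (E : ZEdge D φ δ c0 a b)
    (F : ZEdge D φ δ c0 c d)
    {p q : ℝ × ℝ} (hp : p ∈ segment ℝ (D.pos a) (D.pos b)) (hq : q ∈ segment ℝ (D.pos c) (D.pos d))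
    (hp1 : p.1 = c0) (hq1 : q.1 = c0) (hpq : q.2 < p.2) (hBb : D.EndB φ 1 b)
    (hBd : D.EndB φ (-1) d) : b = d := by
  have hT := H.hT
  have s1 : IsSign 1 := Or.inl rfl
  have s2 : IsSign (-1) := Or.inr rfl
  have hbS := E.zero (right_mem_segment ℝ _ _)
  have hdS := F.zero (right_mem_segment ℝ _ _)
  have hx : (D.pos b).1 = (D.pos d).1 := by
    have h1 : ¬ δ * (D.pos d).1 < δ * (D.pos b).1 :=
      fun h => end1 hT P s1 hδ E F hp hq hp1 hq1 (by linarith) hBd h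
    have h2 : ¬ δ * (D.pos b).1 < δ * (D.pos d).1 :=
      fun h => end1 hT P s2 hδ F E hq hp hq1 hp1 (by linarith) (by rwa [neg_neg]) h
    rcases hδ with rfl | rfl <;> linarith
  by_contra hne
  obtain ⟨m, k, l1, g1, o1⟩ := seg_line hδ (E.xa.trans E.xb)
  obtain ⟨m', k', l2, g2, o2⟩ := seg_line hδ (F.xa.trans F.xb)
  have hp2 := l1 p hp
  have hq2 := l2 q hq
  rw [hp1] at hp2
  rw [hq1] at hq2
  have hd := l2 _ (right_mem_segment ℝ _ _)
  have hb := l1 _ (right_mem_segment ℝ _ _)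
  have hyne : (D.pos b).2 ≠ (D.pos d).2 := fun h => hne (D.inj (Prod.ext hx h))
  have hpos := aff_sign (A := m - m') (B := k - k') (c := c0) (x := (D.pos b).1) hδ
    (by rw [hp2, hq2] at hpq; linarith) E.xb.le (by
      intro y hy1 hy2 h0
      rcases lt_or_eq_of_le hy2 with h | h
      · refine no_cross hδ E F o1 g2 ?_ l1 l2 hy1 h (by rw [← hx]; exact hy2) ?_
        · intro h; rw [hp2, hq2, h] at hpq; exact lt_irrefl _ hpq
        · linarith
      · have : y = (D.pos b).1 := by rcases hδ with rfl | rfl <;> linarith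
        rw [this] at h0
        apply hyne
        rw [hb, hd, ← hx]; linarith)
  have hlt : (D.pos d).2 < (D.pos b).2 := by rw [hb, hd, ← hx]; linarith
  by_cases hn : D.NonExt (D.pos b)
  · have hqi : ((D.pos b).1, ((D.pos b).2 + (D.pos d).2) / 2) ∈ interior D.space :=
      between_interior H hdS.1 hbS.1 (hn.congr rfl) hx.symm rfl (by simp only; linarith)
        (by simp only; linarith)
    set w : ℝ × ℝ := ((D.pos b).1, ((D.pos b).2 + (D.pos d).2) / 2) with hw
    obtain ⟨t, ht, r0, hr0, hray⟩ := ray_tri D w (δ, 0)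
      (((int_ray D hqi (δ, 0)).filter_mono nhdsWithin_le_nhds).mono
        fun r hr => interior_subset hr).frequently
    have hw0 : D.ext φ w = 0 := by
      have a1 := P.mono hT s1 hdS.1 (interior_subset hqi) hx.symm (by simp only [hw]; linarith)
      have a2 := P.mono hT s1 (interior_subset hqi) hbS.1 rfl (by simp only [hw]; linarith)
      rw [hdS.2] at a1
      rw [hbS.2] at a2
      linarith
    have hval : ∀ r : ℝ, 0 ≤ r → r ≤ r0 → D.ext φ (w + r • (δ, (0:ℝ))) =
        r * (D.aext t φ).linear (δ, 0) := by
      intro r h1 h2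
      rw [ext_eq D ht (hray r h1 h2), aff_ray]
      have := hray 0 le_rfl hr0.le
      rw [zero_smul, add_zero] at this
      rw [← ext_eq D ht this, hw0, zero_add]
    rcases le_total 0 ((D.aext t φ).linear (δ, 0)) with h | h
    · refine end2_side hT P s1 hδ hbS.1 F hn hx (by linarith) (q := w) rfl
        (by simp only [hw]; linarith) hr0 (fun r h1 h2 => ⟨tri_sub D ht (hray r h1 h2), ?_⟩) hBb
      rw [hval r h1 h2]
      have := mul_nonneg h1 h
      linarith
    · refine end2_side hT P s2 hδ hdS.1 E (hn.congr hx.symm) hx.symm (by linarith) (q := w)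
        (by simp only [hw]; exact hx)
        (by simp only [hw]; linarith) hr0 (fun r h1 h2 => ⟨tri_sub D ht (hray r h1 h2), ?_⟩) hBd
      rw [hval r h1 h2]
      have := mul_nonneg h1 (neg_nonneg.2 h)
      linarith
  · have := P.strict _ hdS.1 _ hbS.1 hx.symm (fun h => hn (h.congr hx)) hlt
    rw [hdS.2, hbS.2] at this
    exact lt_irrefl _ this

lemma both_ends {D : TriDisk ι} {v : ℝ × ℝ → ℝ × ℝ} (H : Hyp D v) {l : ι → ι → ℝ} {φ : ι → ℝ}
    (P : Pert D l φ) {c0 : ℝ} {a b c d : ι} (E : ZEdge D φ 1 c0 a b)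
    (F : ZEdge D φ 1 c0 c d)
    {p q : ℝ × ℝ} (hp : p ∈ segment ℝ (D.pos a) (D.pos b)) (hq : q ∈ segment ℝ (D.pos c) (D.pos d))
    (hp1 : p.1 = c0) (hq1 : q.1 = c0) (hpq : q.2 < p.2) (hBa : D.EndB φ 1 a) (hBb : D.EndB φ 1 b)
    (hBc : D.EndB φ (-1) c) (hBd : D.EndB φ (-1) d) : False := by
  have h1 := end_eq H P (Or.inl rfl) E F hp hq hp1 hq1 hpq hBb hBd
  have h2 := end_eq H P (Or.inr rfl) E.symm F.symm (by rwa [segment_symm]) (by rwa [segment_symm])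
    hp1 hq1 hpq hBa hBc
  subst h1; subst h2
  obtain ⟨m, k, l1, -, -⟩ := seg_line (Or.inl rfl) (E.xa.trans E.xb)
  have := l1 p hp
  have := l1 q hq
  rw [hp1] at *
  rw [hq1] at *
  linarith

/-- The extreme zero edge. -/
lemma zedge_exists {D : TriDisk ι} (hT : D.TrV) {φ : ι → ℝ} {s : ℝ} (hs : IsSign s)
    {T0 : ι × ι × ι} (hT0 : T0 ∈ D.tris) (hz : ∀ i ∈ vset T0, φ i = 0) {z : ℝ × ℝ}
    (hzi : z ∈ interior (triSet D.pos T0)) (hgen : ∀ i, (D.pos i).1 ≠ z.1) :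
    ∃ p a b, ZEdge D φ 1 z.1 a b ∧ p ∈ openSegment ℝ (D.pos a) (D.pos b) ∧ p.1 = z.1 ∧
      s * z.2 < s * p.2 ∧ (D.IsTop s p ∨ ((∃ k, D.IsEdge a k ∧ φ k ≠ 0) ∧ ∃ k, D.IsEdge b k ∧ φ k ≠ 0)) := by
  classical
  let Z : Finset (ι × ι × ι) := D.tris.filter fun t => ∀ i ∈ vset t, φ i = 0
  have hZc : IsCompact (⋃ t ∈ Z, triSet D.pos t) := Z.isCompact_biUnion fun t _ => tri_compact D t
  have hWc : IsCompact ((⋃ t ∈ Z, triSet D.pos t) ∩ {p | p.1 = z.1}) :=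
    hZc.inter_right (isClosed_eq continuous_fst continuous_const)
  have hT0Z : T0 ∈ Z := by simp only [Z, Finset.mem_filter]; exact ⟨hT0, hz⟩
  have memW : ∀ t ∈ Z, ∀ p ∈ triSet D.pos t, p.1 = z.1 →
      p ∈ ((⋃ t ∈ Z, triSet D.pos t) ∩ {p | p.1 = z.1}) := by
    intro t ht p hp h
    exact ⟨Set.mem_biUnion ht hp, h⟩
  obtain ⟨p, hp, hmax⟩ := hWc.exists_isMaxOn ⟨z, memW T0 hT0Z z (interior_subset hzi) rfl⟩
    (f := fun q => s * q.2) (by fun_prop)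
  have up : ∀ t ∈ Z, ∀ w ∈ interior (triSet D.pos t), w.1 = z.1 → s * w.2 < s * p.2 := by
    intro t ht w hw hw1
    have h : Tendsto (fun r : ℝ => w + r • ((0:ℝ), s)) (𝓝 0) (𝓝 w) := by
      have : Continuous (fun r : ℝ => w + r • ((0:ℝ), s)) := by fun_prop
      simpa using this.tendsto 0
    have := ((h.eventually (isOpen_interior.mem_nhds hw)).filter_mono
      (nhdsWithin_le_nhds (s := Set.Ioi 0))).and self_mem_nhdsWithin
    obtain ⟨r, h, hr⟩ := this.exists
    have := hmax (memW t ht _ (interior_subset h) (by simp [hw1]))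
    simp only [Set.mem_ofPred_eq, Prod.snd_add, Prod.smul_snd, smul_eq_mul] at this
    have h2 := hs.sq
    have h3 : 0 < r := hr
    nlinarith
  have hp1 : p.1 = z.1 := hp.2
  obtain ⟨t, htZ, hpt⟩ := Set.mem_iUnion₂.1 hp.1
  have ht : t ∈ D.tris ∧ ∀ i ∈ vset t, φ i = 0 := by
    simpa only [Z, Finset.mem_filter] using htZ
  obtain ⟨a, ha, b, hb, hab, hseg, hlt⟩ : ∃ a ∈ vset t, ∃ b ∈ vset t, a ≠ b ∧
      p ∈ openSegment ℝ (D.pos a) (D.pos b) ∧ (D.pos a).1 < (D.pos b).1 := by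
    rcases tri_cases D ht.1 hpt with ⟨i, hi, rfl⟩ | ⟨a, ha, b, hb, hab, hseg⟩ | hi
    · exact absurd hp1 (hgen i)
    · rcases lt_trichotomy (D.pos a).1 (D.pos b).1 with h | h | h
      · exact ⟨a, ha, b, hb, hab, hseg, h⟩
      · exfalso
        obtain ⟨r, s, hr, hs, hrs, rfl⟩ := hseg
        simp only [Prod.fst_add, Prod.smul_fst, smul_eq_mul, ← h] at hp1
        apply hgen a
        rw [← hp1, ← add_mul, hrs, one_mul]
      · exact ⟨b, hb, a, ha, hab.symm, by rwa [openSegment_symm], h⟩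
    · exact absurd (up t htZ p hi hp1) (lt_irrefl _)
  have hbet : (D.pos a).1 < p.1 ∧ p.1 < (D.pos b).1 := by
    obtain ⟨r, s, hr, hs, hrs, rfl⟩ := hseg
    have : r = 1 - s := by linarith
    subst this
    simp only [Prod.fst_add, Prod.smul_fst, smul_eq_mul]
    constructor <;> nlinarith
  refine ⟨p, a, b, ⟨⟨t, ht.1, ha, hb⟩, ht.2 a ha, ht.2 b hb, by linarith, by linarith⟩, hseg, hp1,
    up T0 hT0Z z hzi rfl, ?_⟩
  by_cases htop : D.IsTop s p
  · exact Or.inl htop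
  right
  have hpS := tri_sub D ht.1 hpt
  obtain ⟨q, hq, hq1, hq2⟩ : ∃ q ∈ D.space, q.1 = p.1 ∧ s * p.2 < s * q.2 := by
    by_contra hc
    push Not at hc
    exact htop ⟨hpS, hc⟩
  obtain ⟨T', hT', r0, hr0, hray⟩ := ray_tri D p (0, s) (by
    apply Eventually.frequently
    filter_upwards [Ioo_mem_nhdsGT (sub_pos.2 hq2)] with r hr
    rcases hs with rfl | rfl
    · exact slice_mem D hT hpS hq (by simp) (by simp [hq1]) (by simp [hr.1.le])
        (by simp; linarith [hr.2])
    · exact slice_mem D hT hq hpS (by simp [hq1]) (by simp) (by simp; linarith [hr.2])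
        (by simp [hr.1.le]))
  have hpT' : p ∈ triSet D.pos T' := by simpa using hray 0 le_rfl hr0.le
  obtain ⟨h1, h2, -⟩ := hat_seg D ht.1 ha hb hab hseg
  have haT := hat_pos_mem D hT' hpT' h1.ne'
  have hbT := hat_pos_mem D hT' hpT' h2.ne'
  obtain ⟨k, hk, hk0⟩ : ∃ k ∈ vset T', φ k ≠ 0 := by
    by_contra hc
    push Not at hc
    have := hmax (memW T' (by simp only [Z, Finset.mem_filter]; exact ⟨hT', hc⟩) _
      (hray r0 hr0.le le_rfl) (by simp [hp1]))
    simp only [Set.mem_ofPred_eq, Prod.snd_add, Prod.smul_snd, smul_eq_mul] at this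
    nlinarith [hs.sq]
  exact ⟨⟨k, ⟨fun h => hk0 (h ▸ ht.2 a ha), T', hT', haT, hk⟩, hk0⟩,
    ⟨k, ⟨fun h => hk0 (h ▸ ht.2 b hb), T', hT', hbT, hk⟩, hk0⟩⟩

end TriDisk

namespace TriDisk

set_option linter.unusedSectionVars false
variable {ι : Type} [Fintype ι] [DecidableEq ι]
open Filter Topology

/-- The component of the boundary cut off by a spanning edge on the side `s`. -/
lemma comp_sub {D : TriDisk ι} {s : ℝ} (hs : IsSign s) {P Q p0 : ℝ × ℝ} (hPQ : P.1 < Q.1)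
    {m k : ℝ} (hseg : ∀ x, P.1 < x → x < Q.1 → (x, m * x + k) ∈ interior D.space)
    (hP : P.2 = m * P.1 + k) (hQ : Q.2 = m * Q.1 + k)
    (tP : D.IsTop s P) (tQ : D.IsTop s Q)
    (h1 : P.1 < p0.1) (h2 : p0.1 < Q.1) (h3 : s * (m * p0.1 + k) < s * p0.2)
    (hp0 : p0 ∈ frontier D.space) :
    p0 ∈ frontier D.space \ {P, Q} ∧
    ∀ q ∈ connectedComponentIn (frontier D.space \ {P, Q}) p0,
      q ∈ frontier D.space ∧ P.1 < q.1 ∧ q.1 < Q.1 ∧ s * (m * q.1 + k) < s * q.2 := by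
  have hmem : p0 ∈ frontier D.space \ {P, Q} := by
    refine ⟨hp0, ?_⟩
    rintro (rfl | rfl)
    · exact lt_irrefl _ h1
    · exact lt_irrefl _ h2
  refine ⟨hmem, ?_⟩
  set O1 : Set (ℝ × ℝ) := {q | P.1 < q.1 ∧ q.1 < Q.1 ∧ s * (m * q.1 + k) < s * q.2} with hO1
  set O2 : Set (ℝ × ℝ) := {q | P.1 ≤ q.1 ∧ q.1 ≤ Q.1 ∧ s * (m * q.1 + k) ≤ s * q.2}ᶜ with hO2
  have o1 : IsOpen O1 := by
    have a1 : IsOpen {q : ℝ × ℝ | P.1 < q.1} := isOpen_lt (by fun_prop) (by fun_prop)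
    have a2 : IsOpen {q : ℝ × ℝ | q.1 < Q.1} := isOpen_lt (by fun_prop) (by fun_prop)
    have a3 : IsOpen {q : ℝ × ℝ | s * (m * q.1 + k) < s * q.2} :=
      isOpen_lt (by fun_prop) (by fun_prop)
    exact a1.inter (a2.inter a3)
  have o2 : IsOpen O2 := by
    have a1 : IsClosed {q : ℝ × ℝ | P.1 ≤ q.1} := isClosed_le (by fun_prop) (by fun_prop)
    have a2 : IsClosed {q : ℝ × ℝ | q.1 ≤ Q.1} := isClosed_le (by fun_prop) (by fun_prop)
    have a3 : IsClosed {q : ℝ × ℝ | s * (m * q.1 + k) ≤ s * q.2} :=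
      isClosed_le (by fun_prop) (by fun_prop)
    exact (a1.inter (a2.inter a3)).isOpen_compl
  have hd : Disjoint O1 O2 := by
    rw [Set.disjoint_left]
    intro q hq hq2
    exact hq2 ⟨hq.1.le, hq.2.1.le, hq.2.2.le⟩
  have hsub := connectedComponentIn_subset (frontier D.space \ {P, Q}) p0
  have hcov : connectedComponentIn (frontier D.space \ {P, Q}) p0 ⊆ O1 ∪ O2 := by
    intro r hr
    have hr' := hsub hr
    by_cases hr2 : r ∈ O2
    · right; exact hr2
    left
    rw [hO2, Set.mem_compl_iff, not_not] at hr2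
    obtain ⟨e1, e2, e3⟩ := hr2
    have hrS := fr_sub D hr'.1
    have n1 : r.1 ≠ P.1 := by
      intro h
      apply hr'.2
      left
      have := tP.2 r hrS h
      rw [h, ← hP] at e3
      refine Prod.ext h ?_
      rcases hs with rfl | rfl <;> linarith
    have n2 : r.1 ≠ Q.1 := by
      intro h
      apply hr'.2
      right
      have := tQ.2 r hrS h
      rw [h, ← hQ] at e3
      refine Prod.ext h ?_
      rcases hs with rfl | rfl <;> linarith
    have e1' := lt_of_le_of_ne e1 (Ne.symm n1)
    have e2' := lt_of_le_of_ne e2 n2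
    refine ⟨e1', e2', lt_of_le_of_ne e3 fun h => ?_⟩
    have hri := hseg r.1 e1' e2'
    have : (r.1, m * r.1 + k) = r := by
      refine Prod.ext rfl ?_
      show m * r.1 + k = r.2
      rcases hs with rfl | rfl <;> linarith
    rw [this] at hri
    have h' := hr'.1
    rw [frontier_eq] at h'
    exact h'.2 hri
  have := isPreconnected_connectedComponentIn.subset_left_of_subset_union o1 o2 hd hcov
    ⟨p0, mem_connectedComponentIn hmem, h1, h2, h3⟩
  intro q hq
  have h := this hq
  exact ⟨(hsub hq).1, h.1, h.2.1, h.2.2⟩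

lemma top_case {D : TriDisk ι} {v : ℝ × ℝ → ℝ × ℝ} (H : Hyp D v) (hm : D.VMono v)
    {l : ι → ι → ℝ} (W : D.Wts l) {φ : ι → ℝ} (P : Pert D l φ) {α β : ℝ}
    (hΦ : ∀ q ∈ frontier D.space, D.ext φ q = (v q).2 - α * q.1 - β)
    (hno : ∀ a b : ι, ¬ D.Obstructive v a b)
    {s c0 : ℝ} (hs : IsSign s) {a b c d : ι} (E : D.ZEdge φ 1 c0 a b) (F : D.ZEdge φ 1 c0 c d)
    {p q : ℝ × ℝ} (hp : p ∈ openSegment ℝ (D.pos a) (D.pos b))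
    (hq : q ∈ openSegment ℝ (D.pos c) (D.pos d)) (hp1 : p.1 = c0) (hq1 : q.1 = c0)
    (hpq : s * q.2 < s * p.2) (hpt : D.IsTop s p)
    (hk : D.IsTop (-s) q ∨ (∃ k, D.IsEdge c k ∧ φ k ≠ 0) ∧ ∃ k, D.IsEdge d k ∧ φ k ≠ 0) :
    False := by
  obtain ⟨hpS, hp0⟩ := E.zero (openSegment_subset_segment ℝ _ _ hp)
  obtain ⟨hqS, hq0⟩ := F.zero (openSegment_subset_segment ℝ _ _ hq)
  obtain ⟨haS, ha0⟩ := E.zero (left_mem_segment ℝ _ _)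
  obtain ⟨hbS, hb0⟩ := E.zero (right_mem_segment ℝ _ _)
  obtain ⟨hcS, hc0⟩ := F.zero (left_mem_segment ℝ _ _)
  obtain ⟨hdS, hd0⟩ := F.zero (right_mem_segment ℝ _ _)
  have xa := E.xa
  have xb := E.xb
  have xc := F.xa
  have xd := F.xb
  simp only [one_mul] at xa xb xc xd
  have hpf := top_frontier D hs hpt
  have hpN : D.NonExt p := nonext_of_between (Or.inl rfl) haS hbS (by linarith) (by linarith)
  have hqN : D.NonExt q := hpN.congr (by rw [hq1, hp1])
  have hqnt : ¬ D.IsTop (-s) q := by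
    intro h
    have hqf := top_frontier D hs.neg h
    have e1 := hΦ p hpf
    have e2 := hΦ q hqf
    rw [hp0, hp1] at e1
    rw [hq0, hq1] at e2
    have : v p = v q := by
      refine Prod.ext ?_ (by linarith)
      rw [H.hvert p hpf, H.hvert q hqf, hp1, hq1]
    have := H.hinj hpf hqf this
    rw [this] at hpq
    exact lt_irrefl _ hpq
  have hqns : ¬ D.IsTop s q := fun h => by
    have := h.2 p hpS (by rw [hp1, hq1])
    linarith
  obtain ⟨hkc, hkd⟩ := hk.resolve_left hqnt
  obtain ⟨t, ht, hat, hbt⟩ := E.tri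
  obtain ⟨t', ht', hct, hdt⟩ := F.tri
  have hab : a ≠ b := fun h => by rw [h] at xa; linarith
  have hcd : c ≠ d := fun h => by rw [h] at xc; linarith
  have hBc := endB_of W P hs.neg ⟨t', ht', hct⟩ F.za (Or.inl hkc)
  have hBd := endB_of W P hs.neg ⟨t', ht', hdt⟩ F.zb (Or.inl hkd)
  -- support
  have hbe := edge_boundary D ht hat hbt hab hp hpf
  have haf : D.pos a ∈ frontier D.space := hbe.2 (left_mem_segment ℝ _ _)
  have hbf : D.pos b ∈ frontier D.space := hbe.2 (right_mem_segment ℝ _ _)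
  obtain ⟨m, hmm⟩ := support H hm hs hpN hpt
  have evp := hΦ p hpf
  rw [hp0, hp1] at evp
  have hα : m = α := by
    have e1 := hΦ _ haf
    have e2 := hΦ _ hbf
    rw [ha0] at e1
    rw [hb0] at e2
    have f1 := hmm _ haf
    have f2 := hmm _ hbf
    rw [hp1, show (v (D.pos a)).2 - (v p).2 - m * ((D.pos a).1 - c0) =
      (α - m) * ((D.pos a).1 - c0) by linarith] at f1
    rw [hp1, show (v (D.pos b)).2 - (v p).2 - m * ((D.pos b).1 - c0) =
      (α - m) * ((D.pos b).1 - c0) by linarith] at f2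
    rcases hs with rfl | rfl
    · have : α - m ≤ 0 := by by_contra h; nlinarith
      have : 0 ≤ α - m := by by_contra h; nlinarith
      linarith
    · have : α - m ≤ 0 := by by_contra h; nlinarith
      have : 0 ≤ α - m := by by_contra h; nlinarith
      linarith
  have hfr : ∀ r ∈ frontier D.space, s * D.ext φ r ≤ 0 := by
    intro r hr
    have := hmm r hr
    rw [hΦ r hr, show (v r).2 - α * r.1 - β = (v r).2 - (v p).2 - m * (r.1 - p.1) by
      rw [hα, hp1]; linarith]
    exact this
  have hle : ∀ r ∈ D.space, s * D.ext φ r ≤ 0 := by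
    intro r hr
    obtain ⟨r', ht', hx⟩ := exists_top D s hr
    exact (P.mono H.hT hs hr ht'.1 hx.symm (ht'.2 r hr hx.symm)).trans
      (hfr r' (top_frontier D hs ht'))
  have htop : ∀ i, D.pos i ∈ D.space → D.ext φ (D.pos i) = 0 → D.EndB φ (-s) i →
      D.IsTop s (D.pos i) := by
    intro i hiS hi0 hB
    by_contra hnt
    by_cases hN : D.NonExt (D.pos i)
    · refine hB hN (by rwa [neg_neg]) ?_
      filter_upwards [self_mem_nhdsWithin] with r hr
      have := hle r hr
      linarith
    · apply hnt
      refine ⟨hiS, fun r hr hx => ?_⟩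
      by_contra hlt
      have := P.sstrict hs hiS hr hx.symm hN (not_le.mp hlt)
      have := hle r hr
      rw [hi0] at *
      linarith
  have tc := htop c hcS hc0 hBc
  have td := htop d hdS hd0 hBd
  have hqi := nonext_interior' H hs hqS hqN hqns hqnt
  have hinner := edge_interior D ht' hct hdt hcd hq hqi
  obtain ⟨m', k, g1, g2, g3⟩ := seg_line (Or.inl rfl : IsSign (1:ℝ))
    (show 1 * (D.pos c).1 < 1 * (D.pos d).1 by linarith)
  simp only [one_mul] at g2 g3
  have hcf := top_frontier D hs tc
  have hdf := top_frontier D hs td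
  obtain ⟨hpm, hX⟩ := comp_sub (D := D) hs (P := D.pos c) (Q := D.pos d) (p0 := p) (m := m')
    (k := k) (by linarith)
    (fun x h1 h2 => hinner (g3 x h1 h2)) (g1 _ (left_mem_segment ℝ _ _))
    (g1 _ (right_mem_segment ℝ _ _)) tc td (by linarith) (by linarith)
    (by rw [hp1, ← hq1, ← g1 q (openSegment_subset_segment ℝ _ _ hq)]; exact hpq) hpf
  refine hno c d ⟨⟨⟨hcd, t', ht', hct, hdt⟩, hcf, hdf, hinner⟩, p, hpm, ?_⟩
  set X := connectedComponentIn (frontier D.space \ {D.pos c, D.pos d}) p with hXd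
  have hcl : IsClosed (frontier D.space ∩ D.ext φ ⁻¹' {0}) :=
    ((ext_cont D φ).mono (fun r hr => fr_sub D hr)).preimage_isClosed_of_isClosed
      isClosed_frontier isClosed_singleton
  have hXs : closure X ⊆ frontier D.space ∩ D.ext φ ⁻¹' {0} := by
    refine closure_minimal ?_ hcl
    intro r hr
    obtain ⟨e1, e2, e3, e4⟩ := hX r hr
    refine ⟨e1, ?_⟩
    obtain ⟨w1, w2⟩ := F.zero (g2 r.1 e2.le e3.le)
    have h1 := P.mono H.hT hs w1 (fr_sub D e1) rfl e4.le
    rw [w2] at h1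
    have h2 := hfr r e1
    show D.ext φ r = 0
    rcases hs with rfl | rfl <;> linarith
  rw [collinear_iff_exists_forall_eq_smul_vadd]
  refine ⟨(0, β), (1, α), ?_⟩
  rintro _ ⟨r, hr, rfl⟩
  obtain ⟨e1, e2⟩ := hXs hr
  have e3 := hΦ r e1
  rw [show D.ext φ r = 0 from e2] at e3
  refine ⟨r.1, Prod.ext ?_ ?_⟩
  · simp [H.hvert r e1]
  · simp; linarith

end TriDisk

namespace TriDisk

set_option linter.unusedSectionVars false
variable {ι : Type} [Fintype ι] [DecidableEq ι]
open Filter Topology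

/-- A generic interior point of a triangle. -/
lemma generic_pt (D : TriDisk ι) {T0 : ι × ι × ι} (h0 : T0 ∈ D.tris) :
    ∃ z ∈ interior (triSet D.pos T0), ∀ i, (D.pos i).1 ≠ z.1 := by
  have hne : (interior (triSet D.pos T0)).Nonempty := by
    have hn : 0 < (vset T0).card := Finset.card_pos.mpr ⟨T0.1, by simp [vset]⟩
    have hw : ∑ i ∈ vset T0, ((vset T0).card : ℝ)⁻¹ = 1 := by
      rw [Finset.sum_const, nsmul_eq_mul]
      exact mul_inv_cancel₀ (by positivity)
    refine ⟨(vset T0).affineCombination ℝ D.pos (fun _ => ((vset T0).card : ℝ)⁻¹),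
      interior_of_pos D h0 fun i hi => ?_⟩
    rw [Finset.map_affineCombination _ _ _ hw]
    rw [Finset.affineCombination_eq_linear_combination _ _ _ hw]
    rw [Finset.sum_eq_single i]
    · simp only [Function.comp, bc_vert D h0 i hi, if_true, smul_eq_mul, mul_one]
      positivity
    · intro j hj hji
      simp [Function.comp, bc_vert D h0 i hj, hji.symm]
    · intro h; exact absurd hi h
  obtain ⟨z, hz⟩ := hne
  have hcont : Tendsto (fun r : ℝ => z + r • ((1:ℝ), (0:ℝ))) (𝓝 0) (𝓝 z) := by
    have : Continuous (fun r : ℝ => z + r • ((1:ℝ), (0:ℝ))) := by fun_prop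
    simpa using this.tendsto 0
  have hev := hcont.eventually (isOpen_interior.mem_nhds hz)
  have hfin : (Set.range fun i => (D.pos i).1 - z.1).Finite := Set.finite_range _
  have hinf : (Set.Ioi (0:ℝ) ∩ {r | z + r • ((1:ℝ), (0:ℝ)) ∈ interior (triSet D.pos T0)}).Infinite := by
    obtain ⟨ε, hε, hb⟩ := Metric.eventually_nhds_iff.mp hev
    refine (Set.Ioo_infinite hε).mono ?_
    intro r hr
    refine ⟨hr.1, hb ?_⟩
    rw [Real.dist_eq, sub_zero, abs_of_pos hr.1]
    exact hr.2
  obtain ⟨r, hr, hrn⟩ := hinf.exists_notMem_finite hfin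
  refine ⟨_, hr.2, fun i h => hrn ⟨i, ?_⟩⟩
  simp only [Prod.fst_add, Prod.smul_fst, smul_eq_mul, mul_one] at h
  show (D.pos i).1 - z.1 = r
  linarith

lemma lap_const (l : ι → ι → ℝ) (c : ℝ) (i : ι) : lap l (fun _ => c) i = 0 := by
  simp [lap]

lemma Pert.shift {D : TriDisk ι} {l : ι → ι → ℝ} (W : D.Wts l) {u : ι → ℝ} (P : Pert D l u)
    (α β : ℝ) :
    Pert D l (fun i => 1 * u i + 1 * ((-α) * (D.pos i).1 + (-β) * 1)) ∧
    (∀ p ∈ D.space, D.ext (fun i => 1 * u i + 1 * ((-α) * (D.pos i).1 + (-β) * 1)) p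
      = D.ext u p - α * p.1 - β) ∧
    (∀ i, D.Used i → D.NonExt (D.pos i) →
      lap l (fun i => 1 * u i + 1 * ((-α) * (D.pos i).1 + (-β) * 1)) i = lap l u i) := by
  have hext : ∀ p ∈ D.space, D.ext (fun i => 1 * u i + 1 * ((-α) * (D.pos i).1 + (-β) * 1)) p
      = D.ext u p - α * p.1 - β := by
    intro p hp
    rw [ext_lin D u (fun i => (-α) * (D.pos i).1 + (-β) * 1),
      ext_lin D (fun i => (D.pos i).1) (fun _ => 1), ext_x D hp, ext_const D hp]
    ring
  have hlap : ∀ i, D.Used i → D.NonExt (D.pos i) →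
      lap l (fun i => 1 * u i + 1 * ((-α) * (D.pos i).1 + (-β) * 1)) i = lap l u i := by
    intro i hi hn
    rw [lap_lin l u (fun i => (-α) * (D.pos i).1 + (-β) * 1),
      lap_lin l (fun i => (D.pos i).1) (fun _ => 1), lap_x W hi hn, lap_const]
    ring
  refine ⟨⟨?_, ?_, ?_⟩, hext, hlap⟩
  · intro t ht
    rw [slope_lin D t u (fun i => (-α) * (D.pos i).1 + (-β) * 1),
      slope_lin D t (fun i => (D.pos i).1) (fun _ => 1), slope_x D ht, slope_const D ht]
    have := P.slope t ht
    linarith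
  · intro i hi hn s hs ht
    rw [hlap i hi hn]
    exact P.load i hi hn s hs ht
  · intro p hp q hq h hn hlt
    rw [hext p hp, hext q hq, h]
    have := P.strict p hp q hq h hn hlt
    linarith

lemma contra {D : TriDisk ι} {v : ℝ × ℝ → ℝ × ℝ} (H : Hyp D v) (hm : D.VMono v)
    (hno : ∀ a b : ι, ¬ D.Obstructive v a b)
    {l : ι → ι → ℝ} (W : D.Wts l) {u : ι → ℝ} (P : Pert D l u)
    {T0 : ι × ι × ι} (h0 : T0 ∈ D.tris) (hz : D.slope T0 u = 0)
    (hAB : (∀ i, D.Used i → D.NonExt (D.pos i) → ∀ s, IsSign s → D.IsTop s (D.pos i) →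
        s * lap l u i < 0) ∨ (∀ q ∈ frontier D.space, D.ext u q = (v q).2)) : False := by
  obtain ⟨z, hzi, hgen⟩ := generic_pt D h0
  set α := (D.aext T0 u).linear (1, 0) with hα
  set β := (D.aext T0 u) 0 with hβ
  obtain ⟨P', hext, hlap⟩ := P.shift W α β
  set φ : ι → ℝ := fun i => 1 * u i + 1 * ((-α) * (D.pos i).1 + (-β) * 1) with hφ
  have hv0 : ∀ i ∈ vset T0, φ i = 0 := by
    intro i hi
    have hiT := vert_mem D hi
    rw [← ext_vert D h0 hi φ, hext _ (tri_sub D h0 hiT), ext_eq D h0 hiT, aff_decomp]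
    have : (D.aext T0 u).linear (D.pos i) = (D.pos i).1 * α + (D.pos i).2 * D.slope T0 u := by
      rw [hα, slope, ← smul_eq_mul, ← smul_eq_mul, ← map_smul, ← map_smul, ← map_add]
      congr 1
      ext <;> simp
    rw [this, hz]
    ring
  obtain ⟨p, a, b, E, hp, hp1, hpz, hpa⟩ := zedge_exists H.hT (Or.inl rfl : IsSign 1) h0 hv0 hzi hgen
  obtain ⟨q, c, d, F, hq, hq1, hqz, hqa⟩ := zedge_exists H.hT (Or.inr rfl : IsSign (-1)) h0 hv0 hzi hgen
  have hqp : q.2 < p.2 := by linarith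
  have hEB : ∀ {s : ℝ} {a b : ι} {p : ℝ × ℝ}, IsSign s → D.ZEdge φ 1 z.1 a b →
      p ∈ openSegment ℝ (D.pos a) (D.pos b) →
      ((D.IsTop s p ∧ (∀ i, D.Used i → D.NonExt (D.pos i) → ∀ s, IsSign s → D.IsTop s (D.pos i) →
        s * lap l u i < 0)) ∨ ((∃ k, D.IsEdge a k ∧ φ k ≠ 0) ∧ ∃ k, D.IsEdge b k ∧ φ k ≠ 0)) →
      D.EndB φ s a ∧ D.EndB φ s b := by
    intro s a b p hs E hp hh
    have xa := E.xa
    have xb := E.xb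
    obtain ⟨t, ht, hat, hbt⟩ := E.tri
    have hab : a ≠ b := fun h => by rw [h] at xa; linarith
    rcases hh with ⟨htop, hA⟩ | ⟨h1, h2⟩
    · have hbe := edge_boundary D ht hat hbt hab hp (top_frontier D hs htop)
      have key : ∀ i, D.Used i → D.pos i ∈ frontier D.space → D.NonExt (D.pos i) →
          ¬ D.IsTop (-s) (D.pos i) → s * lap l φ i < 0 := by
        intro i hi hf hn hnt
        rw [hlap i hi hn]
        exact hA i hi hn s hs ((frontier_cases' H hs hn hf).resolve_right hnt)
      exact ⟨endB_of W P' hs ⟨t, ht, hat⟩ E.za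
          (Or.inr (key a ⟨t, ht, hat⟩ (hbe.2 (left_mem_segment ℝ _ _)))),
        endB_of W P' hs ⟨t, ht, hbt⟩ E.zb
          (Or.inr (key b ⟨t, ht, hbt⟩ (hbe.2 (right_mem_segment ℝ _ _))))⟩
    · exact ⟨endB_of W P' hs ⟨t, ht, hat⟩ E.za (Or.inl h1),
        endB_of W P' hs ⟨t, ht, hbt⟩ E.zb (Or.inl h2)⟩
  have fin : (D.EndB φ 1 a ∧ D.EndB φ 1 b) → (D.EndB φ (-1) c ∧ D.EndB φ (-1) d) → False :=
    fun h1 h2 => both_ends H P' E F (openSegment_subset_segment ℝ _ _ hp)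
      (openSegment_subset_segment ℝ _ _ hq) hp1 hq1 hqp h1.1 h1.2 h2.1 h2.2
  rcases hAB with hA | hB
  · exact fin (hEB (Or.inl rfl) E hp (hpa.imp (fun h => ⟨h, hA⟩) id))
      (hEB (Or.inr rfl) F hq (hqa.imp (fun h => ⟨h, hA⟩) id))
  · have hΦ : ∀ r ∈ frontier D.space, D.ext φ r = (v r).2 - α * r.1 - β := by
      intro r hr
      rw [hext r (fr_sub D hr), hB r hr]
    rcases hpa with hpt | hpk
    · exact top_case H hm W P' hΦ hno (Or.inl rfl) E F hp hq hp1 hq1 (by linarith) hpt hqa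
    rcases hqa with hqt | hqk
    · exact top_case H hm W P' hΦ hno (Or.inr rfl) F E hq hp hq1 hp1 (by linarith) hqt
        (Or.inr hpk)
    · exact fin (hEB (Or.inl rfl) E hp (Or.inr hpk)) (hEB (Or.inr rfl) F hq (Or.inr hqk))

/-- All slopes of the harmonic extension are positive. -/
lemma slopes_pos {D : TriDisk ι} {v : ℝ × ℝ → ℝ × ℝ} (H : Hyp D v) (hm : D.VMono v)
    (hno : ∀ a b : ι, ¬ D.Obstructive v a b)
    {l : ι → ι → ℝ} (W : D.Wts l) {h : ι → ℝ}
    (hh : ∀ i, D.Used i → D.pos i ∈ interior D.space → lap l h i = 0)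
    (hb : ∀ i, D.Used i → D.pos i ∈ frontier D.space → h i = (v (D.pos i)).2)
    {T0 : ι × ι × ι} (h0 : T0 ∈ D.tris) (hmin : ∀ t ∈ D.tris, D.slope T0 h ≤ D.slope t h) :
    0 < D.slope T0 h := by
  by_contra hneg
  set σ := D.slope T0 h with hσ
  have hσ0 : σ ≤ 0 := not_lt.mp hneg
  obtain ⟨τ, hτ⟩ : ∃ τ : ℝ, τ = 1 / (1 - σ) := ⟨_, rfl⟩
  have hpos : 0 < 1 - σ := by linarith
  have hτ0 : 0 < τ := by rw [hτ]; positivity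
  have hτe : τ * (1 - σ) = 1 := by rw [hτ]; field_simp
  have hτ1 : τ ≤ 1 := by nlinarith
  set u : ι → ℝ := fun i => (1 - τ) * (D.pos i).2 + τ * h i with hu
  have hsl : ∀ t ∈ D.tris, D.slope t u = (1 - τ) + τ * D.slope t h := by
    intro t ht
    rw [hu, slope_lin D t (fun i => (D.pos i).2) h, slope_y D ht]; ring
  have hla : ∀ i, lap l u i = (1 - τ) * (∑ j, l i j * ((D.pos j).2 - (D.pos i).2))
      + τ * lap l h i := by
    intro i
    rw [hu, lap_lin l (fun i => (D.pos i).2) h]; rfl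
  have hex : ∀ p ∈ D.space, D.ext u p = (1 - τ) * p.2 + τ * D.ext h p := by
    intro p hp
    rw [hu, ext_lin D (fun i => (D.pos i).2) h, ext_y D hp]
  have hytop : ∀ i, D.Used i → D.NonExt (D.pos i) → ∀ s, IsSign s → ¬ D.IsTop (-s) (D.pos i) →
      s * (∑ j, l i j * ((D.pos j).2 - (D.pos i).2)) ≤ 0 := by
    intro i hi hn s hs hnt
    by_cases ht : D.IsTop s (D.pos i)
    · exact (W.ytop i hi hn s hs ht).le
    · rw [W.ybal i hi hn (nonext_interior' H hs hi.mem hn ht hnt)]; simp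
  have hS0 : D.slope T0 u = 0 := by rw [hsl T0 h0, ← hσ]; linarith
  have P : Pert D l u := by
    refine ⟨?_, ?_, ?_⟩
    · intro t ht
      rw [hsl t ht]
      have := hmin t ht
      nlinarith
    · intro i hi hn s hs hnt
      rw [hla]
      have h1 := hytop i hi hn s hs hnt
      have h2 := load H hm W hh hb hi hn hs hnt
      have : s * ((1 - τ) * (∑ j, l i j * ((D.pos j).2 - (D.pos i).2)) + τ * lap l h i) =
        (1 - τ) * (s * (∑ j, l i j * ((D.pos j).2 - (D.pos i).2))) + τ * (s * lap l h i) := by ring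
      rw [this]
      nlinarith
    · intro p hp q hq hx hn hlt
      rw [hex p hp, hex q hq]
      have hpf := ext_frontier D hp hn
      have hqf := ext_frontier D hq (fun h' => hn (h'.congr hx))
      rw [ext_frontier_eq H hb hpf, ext_frontier_eq H hb hqf]
      have := hm p hpf q hqf hx hlt
      nlinarith
  refine contra H hm hno W P h0 hS0 ?_
  rcases hτ1.lt_or_eq with h1 | h1
  · left
    intro i hi hn s hs ht
    rw [hla]
    have e1 := W.ytop i hi hn s hs ht
    have e2 := load H hm W hh hb hi hn hs (fun h' => top_ne' H hs hn ht h')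
    have : s * ((1 - τ) * (∑ j, l i j * ((D.pos j).2 - (D.pos i).2)) + τ * lap l h i) =
        (1 - τ) * (s * (∑ j, l i j * ((D.pos j).2 - (D.pos i).2))) + τ * (s * lap l h i) := by ring
    rw [this]
    nlinarith
  · right
    intro q hq
    rw [hex q (fr_sub D hq), ext_frontier_eq H hb hq, h1]
    ring

theorem core {D : TriDisk ι} {v : ℝ × ℝ → ℝ × ℝ} (H : Hyp D v) (hm : D.VMono v)
    (hno : ∀ a b : ι, ¬ D.Obstructive v a b) :
    ∃ G : ℝ × ℝ → ℝ × ℝ, D.SLOn G ∧ Set.InjOn G D.space ∧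
      TriDisk.VerticalOn G D.space ∧ Set.EqOn G v (frontier D.space) := by
  obtain ⟨l, W⟩ := exists_wts H
  obtain ⟨h, hh, hb⟩ := exists_harm W (fun i => (v (D.pos i)).2)
  obtain ⟨T0, h0, hmin⟩ := D.tris.exists_min_image (fun t => D.slope t h) D.nonempty
  have hpos := slopes_pos H hm hno W hh hb h0 hmin
  have key : ∀ p ∈ D.space, ∀ q ∈ D.space, p.1 = q.1 → D.ext h p = D.ext h q → p.2 ≤ q.2 →
      p = q := by
    intro p hp q hq h1 h2 h3
    have := mono_slice D H.hT h _ hmin hp hq h1 h3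
    refine Prod.ext h1 (le_antisymm h3 ?_)
    by_contra hlt
    nlinarith
  refine ⟨fun p => (p.1, D.ext h p), ?_, ?_, fun p _ => rfl, ?_⟩
  · intro t ht
    refine ⟨(LinearMap.fst ℝ ℝ ℝ).toAffineMap.prod (D.aext t h), fun p hp => ?_⟩
    refine Prod.ext rfl ?_
    exact ext_eq D ht hp h
  · intro p hp q hq hpq
    obtain ⟨h1, h2⟩ := Prod.mk.inj hpq
    rcases le_total p.2 q.2 with h3 | h3
    · exact key p hp q hq h1 h2 h3
    · exact (key q hq p hp h1.symm h2.symm h3).symm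
  · intro p hp
    exact Prod.ext (H.hvert p hp).symm (ext_frontier_eq H hb hp)

/-- The reflection in the horizontal axis. -/
def flip : (ℝ × ℝ) ≃L[ℝ] (ℝ × ℝ) :=
  (ContinuousLinearEquiv.refl ℝ ℝ).prodCongr (ContinuousLinearEquiv.neg ℝ)

lemma flip_apply (p : ℝ × ℝ) : flip p = (p.1, -p.2) := rfl

lemma flip_flip (p : ℝ × ℝ) : flip (flip p) = p := by simp [flip_apply]

/-- The reflection as an affine map. -/
def flipA : (ℝ × ℝ) →ᵃ[ℝ] (ℝ × ℝ) := (flip : (ℝ × ℝ) →ₗ[ℝ] (ℝ × ℝ)).toAffineMap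

lemma flipA_apply (p : ℝ × ℝ) : flipA p = flip p := rfl

lemma Hyp.flip {D : TriDisk ι} {v : ℝ × ℝ → ℝ × ℝ} (H : Hyp D v) :
    Hyp D (fun p => TriDisk.flip (v p)) := by
  refine ⟨H.hT, ?_, ?_, ?_, ?_⟩
  · intro a b hab
    obtain ⟨g, hg⟩ := H.hSL a b hab
    exact ⟨flipA.comp g, fun p hp => by
      show TriDisk.flip (v p) = flipA (g p)
      rw [hg hp]; rfl⟩
  · intro p hp q hq h
    exact H.hinj hp hq (TriDisk.flip.injective h)
  · intro p hp
    exact H.hvert p hp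
  · obtain ⟨C, h1, h2, h3, h4⟩ := H.hconv
    have e : ∀ s : Set (ℝ × ℝ), TriDisk.flip '' s = TriDisk.flip.toHomeomorph '' s := fun s => rfl
    refine ⟨TriDisk.flip '' C, ?_, h2.image TriDisk.flip.continuous, ?_, ?_⟩
    · exact h1.linear_image (TriDisk.flip : (ℝ × ℝ) →ₗ[ℝ] (ℝ × ℝ))
    · rw [e, ← Homeomorph.image_interior]
      exact h3.image _
    · rw [e, ← Homeomorph.image_frontier, ← h4, Set.image_image]
      rfl

end TriDisk

theorem main_lemma_vertical_extension
    {ι : Type} [Fintype ι] [DecidableEq ι]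
    (D : TriDisk ι) (hTrV : D.TrV)
    (v : ℝ × ℝ → ℝ × ℝ)
    (hSL : D.SLOnBoundary v)
    (hinj : Set.InjOn v (frontier D.space))
    (hvert : TriDisk.VerticalOn v (frontier D.space))
    (hconv : D.ConvexImage v)
    (hnoobs : ∀ a b : ι, ¬ D.Obstructive v a b) :
    ∃ G : ℝ × ℝ → ℝ × ℝ,
      D.SLOn G ∧
      Set.InjOn G D.space ∧
      TriDisk.VerticalOn G D.space ∧
      Set.EqOn G v (frontier D.space) := by
  have H : D.Hyp v := ⟨hTrV, hSL, hinj, hvert, hconv⟩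
  obtain ⟨s, hs, ho⟩ := TriDisk.orient H
  rcases hs with rfl | rfl
  · refine TriDisk.core H (TriDisk.vmono_of H fun p q h1 h2 h3 => ?_) hnoobs
    have := ho p q h1 h2 h3
    linarith
  · have hm := TriDisk.vmono_of H.flip fun p q h1 h2 h3 => by
      have := ho p q h1 h2 h3
      show -(v q).2 ≤ -(v p).2
      linarith
    obtain ⟨G, g1, g2, g3, g4⟩ := TriDisk.core H.flip hm (by
      rintro a b ⟨hab, x, hx, hc⟩
      refine hnoobs a b ⟨hab, x, hx, ?_⟩
      rw [collinear_iff_exists_forall_eq_smul_vadd] at hc ⊢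
      obtain ⟨p0, w, hw⟩ := hc
      refine ⟨TriDisk.flip p0, TriDisk.flip w, ?_⟩
      rintro _ ⟨r, hr, rfl⟩
      obtain ⟨c, hc⟩ := hw _ ⟨r, hr, rfl⟩
      refine ⟨c, ?_⟩
      have h2 := congrArg TriDisk.flip hc
      rw [TriDisk.flip_flip] at h2
      rw [h2, vadd_eq_add, vadd_eq_add, map_add, map_smul])
    refine ⟨fun p => TriDisk.flip (G p), ?_, ?_, ?_, ?_⟩
    · intro t ht
      obtain ⟨g, hg⟩ := g1 t ht
      exact ⟨TriDisk.flipA.comp g, fun p hp => by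
        show TriDisk.flip (G p) = TriDisk.flipA (g p)
        rw [hg hp]; rfl⟩
    · intro p hp q hq h
      exact g2 hp hq (TriDisk.flip.injective h)
    · intro p hp
      exact g3 p hp
    · intro p hp
      show TriDisk.flip (G p) = v p
      rw [g4 hp, TriDisk.flip_flip]
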